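/- arXiv:1008.1485 — 5 statements merged into one kernel-verified Lean document; each statement's English description precedes it below -/
import Mathlib

section
/- For r ≥ 0 and any collection E = (E_0, E_1, …, E_r) of distinct rank one reflexive sheaves on X, the quiver of sections Q of E is strongly connected (there is a directed path between any ordered pair of vertices), the toric algebra A_E is isomorphic as a k-algebra to End_R(⊕_{i∈Q₀} E_i), and the centre Z(A_E) is isomorphic to R. -/
open scoped Pointwise

namespace NCCell
/-- Toric data for a normal affine toric variety `X = Spec k[σ^∨ ∩ M]` of dimension `n`
with a torus-invariant point: the strongly convex, full-dimensional rational cone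
`σ ⊆ ℝⁿ` is recorded through the primitive generators `v ρ` of its `d` extremal rays. -/
structure ToricData (n d : ℕ) where
  v : Fin d → Fin n → ℤ
  primitive : ∀ ρ, Finset.univ.gcd (fun i => (v ρ i).natAbs) = 1
  strongly_convex : ∃ u : Fin n → ℤ, ∀ ρ, 0 < ∑ i, u i * v ρ i
  full_dim : ∀ u : Fin n → ℤ, (∀ ρ, ∑ i, u i * v ρ i = 0) → u = 0
  extremal_rays : ∀ ρ : Fin d, ∃ u : Fin n → ℤ,
    (∑ i, u i * v ρ i = 0) ∧ ∀ ρ', ρ' ≠ ρ → 0 < ∑ i, u i * v ρ' i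

namespace ToricData
variable {n d : ℕ} (T : ToricData n d)
/-- The inclusion `M = ℤⁿ → ℤᵈ`, `u ↦ (⟨u, v_ρ⟩)_ρ`, from the exact sequence
`0 → M → ℤᵈ → Cl(X) → 0`. -/
def iota : (Fin n → ℤ) →+ (Fin d → ℤ) where
  toFun u := fun ρ => ∑ i, u i * T.v ρ i
  map_zero' := by funext ρ; simp
  map_add' u w := by funext ρ; simp [add_mul, Finset.sum_add_distrib]
/-- The sublattice of `ℤᵈ` of principal torus-invariant Weil divisors, i.e. the image
of `M`; the class group `Cl(X)` is the quotient `ℤᵈ ⧸ prin`. -/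
def prin : AddSubgroup (Fin d → ℤ) := T.iota.range
/-- `X` is Gorenstein: `(1,…,1)` lies in (the image of) `M`. -/
def Gorenstein : Prop := (fun _ => 1 : Fin d → ℤ) ∈ T.prin
end ToricData

def toInt {d : ℕ} (u : Fin d → ℕ) : Fin d → ℤ := fun ρ => (u ρ : ℤ)

/-- A collection of distinct rank one reflexive sheaves on `X`, recorded through Weil
divisor representatives `D i` of their divisor classes. -/
structure Collection {n d : ℕ} (T : ToricData n d) (I : Type*) where
  D : I → Fin d → ℤ
  distinct : ∀ i j : I, D i - D j ∈ T.prin → i = j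

namespace Collection
section
variable {n d : ℕ} {T : ToricData n d} {I : Type*} (C : Collection T I)
/-- `u ∈ ℕᵈ` is (the divisor of zeroes of) a torus-invariant section of
`Hom(E_i, E_j) = H⁰(X, O_X(D_j - D_i))`, i.e. `u` is effective of class `[D_j - D_i]`. -/
def IsSection (i j : I) (u : Fin d → ℕ) : Prop :=
  toInt u - (C.D j - C.D i) ∈ T.prin
/-- A torus-invariant section is irreducible if it admits no nontrivial factorisation
through a member of the collection. -/
def IsIrreducible (i j : I) (u : Fin d → ℕ) : Prop :=
  C.IsSection i j u ∧
    ∀ (l : I) (u₁ u₂ : Fin d → ℕ), u = u₁ + u₂ →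
      C.IsSection i l u₂ → C.IsSection l j u₁ →
      (l = i ∧ u₂ = 0) ∨ (l = j ∧ u₁ = 0)
/-- An arrow of the quiver of sections `Q` of the collection: an irreducible
torus-invariant section, with its head, tail and labelling divisor `div(a) ∈ ℕᵈ`. -/
structure Arrow where
  src : I
  tgt : I
  lab : Fin d → ℕ
  irred : C.IsIrreducible src tgt lab
  nontriv : ¬ (src = tgt ∧ lab = 0)
/-- Paths in the quiver of sections (`nil i` is the trivial path `e_i`, and
`cons p a _` is the path `a·p`, i.e. `a` traversed last). -/
inductive Path : I → I → Type _
  | nil (i : I) : Path i i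
  | cons {i j : I} (p : Path i j) (a : C.Arrow) (h : a.src = j) : Path i a.tgt
end

section
variable {n d : ℕ} {T : ToricData n d} {I : Type*} {C : Collection T I}
/-- The labelling divisor `div(p) ∈ ℕᵈ` of a path. -/
def Path.lab {i : I} : {j : I} → C.Path i j → (Fin d → ℕ)
  | _, .nil _ => 0
  | _, .cons p a _ => Path.lab p + a.lab
/-- Composition of paths: `p.comp q` traverses `p` first, then `q`. -/
def Path.comp {i j : I} (p : C.Path i j) : {l : I} → C.Path j l → C.Path i l
  | _, .nil _ => p
  | _, .cons q a h => .cons (Path.comp p q) a h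
/-- The arrow traversed last by a path. -/
def Path.lastArrow? {i : I} : {j : I} → C.Path i j → Option (C.Arrow)
  | _, .nil _ => none
  | _, .cons _ a _ => some a
/-- The arrow traversed first by a path. -/
def Path.firstArrow? {i : I} : {j : I} → C.Path i j → Option (C.Arrow)
  | _, .nil _ => none
  | _, .cons p a _ => some ((Path.firstArrow? p).getD a)
/-- The list of arrows traversed by a path (last traversed first). -/
def Path.arrows {i : I} : {j : I} → C.Path i j → List (C.Arrow)
  | _, .nil _ => []
  | _, .cons p a _ => a :: Path.arrows p

/-- `pp - pm` is one of the generating relations of the ideal of superpotential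
relations `J_W`: there is a path `q` such that the derivative `∂_q W` of the
superpotential `W = Σ_{p anticanonical cycle} p` is the sum of precisely the two paths
`pp` and `pm`, and these two paths share neither initial nor final arrow.  (Here
`∂_q W` is the sum of all paths `p` with tail at `h(q)`, head at `t(q)` and labelling
monomial `x^{div p} = Π_ρ x_ρ / x^{div q}`.) -/
def IsSPRel {i j : I} (pp pm : C.Path i j) : Prop :=
  ∃ q : C.Path j i,
    (∀ ρ, pp.lab ρ + q.lab ρ = 1) ∧ (∀ ρ, pm.lab ρ + q.lab ρ = 1) ∧
    pp ≠ pm ∧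
    pp.firstArrow? ≠ pm.firstArrow? ∧ pp.lastArrow? ≠ pm.lastArrow? ∧
    (∀ p : C.Path i j, (∀ ρ, p.lab ρ + q.lab ρ = 1) → p = pp ∨ p = pm)

/-- F-term equivalence of paths: the equivalence relation generated by
`q₂ p₊ q₁ ∼ q₂ p₋ q₁` for superpotential relations `p₊ - p₋ ∈ J_W`.  Two paths are
identified in the superpotential algebra `A_W = kQ/J_W` iff they are F-term equivalent. -/
inductive FTermEquiv : {i j : I} → C.Path i j → C.Path i j → Prop
  | rel {i j l m : I} {pp pm : C.Path i j} (q₁ : C.Path l i) (q₂ : C.Path j m)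
      (h : IsSPRel pp pm) :
      FTermEquiv ((q₁.comp pp).comp q₂) ((q₁.comp pm).comp q₂)
  | refl {i j : I} (p : C.Path i j) : FTermEquiv p p
  | symm {i j : I} {p q : C.Path i j} : FTermEquiv p q → FTermEquiv q p
  | trans {i j : I} {p q r : C.Path i j} : FTermEquiv p q → FTermEquiv q r → FTermEquiv p r
end

/-- The toric algebra `A_𝓔 = kQ/J_𝓔` is consistent, i.e. `J_𝓔 = J_W`: since (classes of)
paths form bases of both quotient algebras, this says precisely that two paths of `Q`
with the same head and tail are identified in `A_𝓔` (i.e. share the same labelling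
divisor) if and only if they are identified in `A_W` (i.e. are F-term equivalent). -/
def Consistent {n d : ℕ} {T : ToricData n d} {I : Type*} (C : Collection T I) : Prop :=
  ∀ (i j : I) (p q : C.Path i j), p.lab = q.lab ↔ FTermEquiv p q

end Collection
end NCCell

namespace NCCell
section
variable (k : Type) [Field k] {n d : ℕ} (T : ToricData n d)

/-- The set of torus-invariant sections of `O_X(D)`: `H⁰(X, O_X(D))` has a basis of
monomials `x^m`, `m ∈ M`, with `div(x^m) + D ≥ 0`; realising `x^m` as the monomial
with exponent `ι(m) ∈ ℤᵈ` of the Laurent--Cox algebra `k[ℤᵈ]` identifies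
`H⁰(X, O_X(D))` with the span of this set. -/
def secSet (D : Fin d → ℤ) : Set (AddMonoidAlgebra k (Fin d → ℤ)) :=
  {f | ∃ w : Fin d → ℤ, w ∈ T.prin ∧ (∀ ρ, 0 ≤ w ρ + D ρ) ∧
        f = AddMonoidAlgebra.single w 1}

lemma secSet_mul_subset (D D' : Fin d → ℤ) :
    secSet k T D * secSet k T D' ⊆
      (Submodule.span k (secSet k T (D + D')) : Set (AddMonoidAlgebra k (Fin d → ℤ))) := by
  rintro x hx
  rw [Set.mem_mul] at hx
  obtain ⟨y, hy, z, hz, rfl⟩ := hx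
  obtain ⟨w, hw, hwn, rfl⟩ := hy
  obtain ⟨w', hw', hwn', rfl⟩ := hz
  refine Submodule.subset_span ⟨w + w', add_mem hw hw', fun ρ => ?_, ?_⟩
  · have := add_nonneg (hwn ρ) (hwn' ρ)
    have h2 : w ρ + D ρ + (w' ρ + D' ρ) = (w + w') ρ + (D + D') ρ := by
      simp [Pi.add_apply]; ring
    rwa [h2] at this
  · rw [AddMonoidAlgebra.single_mul_single, one_mul]

lemma span_secSet_mul_le (D D' : Fin d → ℤ) {x y : AddMonoidAlgebra k (Fin d → ℤ)}
    (hx : x ∈ Submodule.span k (secSet k T D)) (hy : y ∈ Submodule.span k (secSet k T D')) :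
    x * y ∈ Submodule.span k (secSet k T (D + D')) := by
  have h := Submodule.mul_mem_mul hx hy
  rw [Submodule.span_mul_span] at h
  exact Submodule.span_le.mpr (secSet_mul_subset k T D D') h

lemma one_mem_span_secSet (D : Fin d → ℤ) (hD : D = 0) :
    (1 : AddMonoidAlgebra k (Fin d → ℤ)) ∈ Submodule.span k (secSet k T D) := by
  refine Submodule.subset_span ⟨0, zero_mem _, by simp [hD], ?_⟩
  rw [AddMonoidAlgebra.one_def]

/-- The coordinate ring `R = k[σ^∨ ∩ M]` of `X`, realised as the subalgebra of the
Laurent--Cox algebra `k[ℤᵈ]` spanned by the effective invariant monomials, i.e. as the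
module of sections `H⁰(X, O_X)`. -/
def coordRing : Subalgebra k (AddMonoidAlgebra k (Fin d → ℤ)) where
  carrier := Submodule.span k (secSet k T 0)
  add_mem' := fun ha hb => add_mem ha hb
  zero_mem' := zero_mem _
  mul_mem' := fun {a b} ha hb => by
    have := span_secSet_mul_le k T 0 0 ha hb
    simpa using this
  one_mem' := one_mem_span_secSet k T 0 rfl
  algebraMap_mem' := fun r => by
    rw [Algebra.algebraMap_eq_smul_one]
    exact Submodule.smul_mem _ _ (one_mem_span_secSet k T 0 rfl)
end

section
variable (k : Type) [Field k] {n d : ℕ} {T : ToricData n d} {I : Type}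
  [Fintype I] [DecidableEq I] (C : Collection T I)

/-- The endomorphism algebra `End_R(⊕_{i ∈ Q₀} E_i)` of the collection, realised as
the algebra of `Q₀ × Q₀` matrices whose `(i,j)` entry lies in
`Hom(E_j, E_i) = H⁰(X, O_X(D_i - D_j))` (a subalgebra of the matrix algebra over the
Laurent--Cox ring; composition of homomorphisms between the reflexive modules `E_i` is
multiplication of sections). -/
def endAlgebra : Subalgebra k (Matrix I I (AddMonoidAlgebra k (Fin d → ℤ))) where
  carrier := {m | ∀ i j, m i j ∈ Submodule.span k (secSet k T (C.D i - C.D j))}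
  add_mem' := fun ha hb i j => by
    have := add_mem (ha i j) (hb i j)
    simpa [Matrix.add_apply] using this
  zero_mem' := fun i j => by simp [Matrix.zero_apply]
  mul_mem' := fun {a b} ha hb i j => by
    rw [Matrix.mul_apply]
    refine Submodule.sum_mem _ fun l _ => ?_
    have h := span_secSet_mul_le k T _ _ (ha i l) (hb l j)
    have e : (C.D i - C.D l) + (C.D l - C.D j) = C.D i - C.D j := by ring
    rwa [e] at h
  one_mem' := fun i j => by
    by_cases h : i = j
    · subst h
      simp only [Matrix.one_apply_eq]
      exact one_mem_span_secSet k T _ (by ring)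
    · simp [Matrix.one_apply_ne h]
  algebraMap_mem' := fun r i j => by
    by_cases h : i = j
    · subst h
      rw [Matrix.algebraMap_eq_diagonal]
      simp only [Matrix.diagonal_apply_eq]
      rw [Pi.algebraMap_apply, Algebra.algebraMap_eq_smul_one]
      exact Submodule.smul_mem _ _ (one_mem_span_secSet k T _ (by ring))
    · rw [Matrix.algebraMap_eq_diagonal]
      simp [Matrix.diagonal_apply_ne _ h]
end

namespace Collection
section
variable {k : Type} [Field k] {n d : ℕ} {T : ToricData n d} {I : Type} {C : Collection T I}

/-- The element of the path algebra `kQ` — presented by generators `e i` (`i ∈ Q₀`) and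
`a ∈ Q₁` inside the free algebra — determined by a path (composition is written right
to left). -/
def pathElem (k : Type) [Field k] {i : I} :
    {j : I} → C.Path i j → FreeAlgebra k (I ⊕ C.Arrow)
  | _, .nil _ => FreeAlgebra.ι k (Sum.inl i)
  | _, .cons p a _ => FreeAlgebra.ι k (Sum.inr a) * pathElem k p
end

/-- The relations presenting the toric algebra `A_𝓔 = kQ/J_𝓔` of a collection: the
path algebra relations for the vertex idempotents and the arrows, together with the
relations `p - q` for all pairs of paths with the same head, tail and labelling
divisor (the ideal `J_𝓔`). -/
inductive PathAlgRel (k : Type) [Field k] {n d : ℕ} {T : ToricData n d} {I : Type}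
    [Fintype I] (C : Collection T I) :
    FreeAlgebra k (I ⊕ C.Arrow) → FreeAlgebra k (I ⊕ C.Arrow) → Prop
  | orth (i j : I) (h : i ≠ j) :
      PathAlgRel k C (FreeAlgebra.ι k (Sum.inl i) * FreeAlgebra.ι k (Sum.inl j)) 0
  | idem (i : I) :
      PathAlgRel k C (FreeAlgebra.ι k (Sum.inl i) * FreeAlgebra.ι k (Sum.inl i))
        (FreeAlgebra.ι k (Sum.inl i))
  | sum : PathAlgRel k C (∑ i : I, FreeAlgebra.ι k (Sum.inl i)) 1
  | hd (a : C.Arrow) :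
      PathAlgRel k C (FreeAlgebra.ι k (Sum.inl a.tgt) * FreeAlgebra.ι k (Sum.inr a))
        (FreeAlgebra.ι k (Sum.inr a))
  | tl (a : C.Arrow) :
      PathAlgRel k C (FreeAlgebra.ι k (Sum.inr a) * FreeAlgebra.ι k (Sum.inl a.src))
        (FreeAlgebra.ι k (Sum.inr a))
  | labelEq {i j : I} (p q : C.Path i j) (h : p.lab = q.lab) :
      PathAlgRel k C (pathElem k p) (pathElem k q)

/-- The toric algebra `A_𝓔 = kQ/J_𝓔` of the collection `𝓔`. -/
abbrev toricAlgebra (k : Type) [Field k] {n d : ℕ} {T : ToricData n d} {I : Type}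
    [Fintype I] (C : Collection T I) :=
  RingQuot (PathAlgRel k C)

end Collection
end NCCell

namespace NCCell

lemma toInt_add {d : ℕ} (u w : Fin d → ℕ) : toInt (u + w) = toInt u + toInt w := by
  funext ρ; simp [toInt]

lemma toInt_zero {d : ℕ} : toInt (0 : Fin d → ℕ) = 0 := by
  funext ρ; simp [toInt]

lemma toInt_injective {d : ℕ} : Function.Injective (toInt (d := d)) := by
  intro u w h
  funext ρ
  exact Nat.cast_injective (R := ℤ) (congrFun h ρ)

/-- Every divisor class has an effective representative. -/
lemma ToricData.exists_prin_add_nonneg {n d : ℕ} (T : ToricData n d) (D : Fin d → ℤ) :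
    ∃ w ∈ T.prin, ∀ ρ, 0 ≤ w ρ + D ρ := by
  obtain ⟨u, hu⟩ := T.strongly_convex
  refine ⟨(∑ ρ, |D ρ|) • T.iota u, zsmul_mem (AddMonoidHom.mem_range.mpr ⟨u, rfl⟩) _, fun ρ => ?_⟩
  have hbound : |D ρ| ≤ ∑ ρ, |D ρ| :=
    Finset.single_le_sum (f := fun ρ => |D ρ|) (fun _ _ => abs_nonneg _) (Finset.mem_univ ρ)
  have hpos : 1 ≤ T.iota u ρ := hu ρ
  have habs := neg_abs_le (D ρ)
  have hsum : 0 ≤ ∑ ρ, |D ρ| := (abs_nonneg _).trans hbound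
  simp only [Pi.smul_apply, smul_eq_mul]
  nlinarith

namespace Collection
section Quiver
variable {n d : ℕ} {T : ToricData n d} {I : Type*} {C : Collection T I}

lemma IsSection.refl (i : I) : C.IsSection i i 0 := by
  simp [IsSection, toInt_zero, zero_mem]

lemma IsSection.add {i j l : I} {u w : Fin d → ℕ} (hu : C.IsSection i j u)
    (hw : C.IsSection j l w) : C.IsSection i l (u + w) := by
  have h := add_mem hu hw
  unfold IsSection
  rw [toInt_add]
  convert h using 1
  abel

lemma IsSection.eq_of_zero {i j : I} (h : C.IsSection i j 0) : j = i := by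
  refine C.distinct j i ?_
  have := neg_mem h
  simpa [toInt_zero] using this

lemma Path.isSection {i j : I} (p : C.Path i j) : C.IsSection i j p.lab := by
  induction p with
  | nil => exact IsSection.refl _
  | cons p a h ih =>
    subst h
    exact ih.add a.irred.1

lemma Path.lab_comp {i j l : I} (p : C.Path i j) (q : C.Path j l) :
    (p.comp q).lab = p.lab + q.lab := by
  induction q with
  | nil => simp [Path.comp, Path.lab]
  | cons q a h ih => simp [Path.comp, Path.lab, ih, add_assoc]

/-- Every torus-invariant section between members of the collection labels a path. -/
lemma IsSection.exists_path {i j : I} {u : Fin d → ℕ} (hu : C.IsSection i j u) :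
    ∃ p : C.Path i j, p.lab = u := by
  induction hN : ∑ ρ, u ρ using Nat.strong_induction_on generalizing i j u with
  | _ N ih =>
    have sum_pos {w : Fin d → ℕ} (hw : w ≠ 0) : 0 < ∑ ρ, w ρ := by
      obtain ⟨ρ, hρ⟩ := Function.ne_iff.mp hw
      exact Finset.sum_pos' (fun _ _ => Nat.zero_le _) ⟨ρ, Finset.mem_univ ρ, Nat.pos_of_ne_zero hρ⟩
    by_cases hirr : C.IsIrreducible i j u
    · by_cases htriv : i = j ∧ u = 0
      · obtain ⟨rfl, rfl⟩ := htriv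
        exact ⟨.nil i, rfl⟩
      · exact ⟨.cons (.nil i) ⟨i, j, u, hirr, htriv⟩ rfl, by simp [Path.lab]⟩
    · simp only [IsIrreducible, hu, true_and, not_forall, not_or] at hirr
      obtain ⟨l, u₁, u₂, rfl, h₂, h₁, hn₂, hn₁⟩ := hirr
      have hu₂ : u₂ ≠ 0 := by
        rintro rfl
        exact hn₂ ⟨h₂.eq_of_zero, rfl⟩
      have hu₁ : u₁ ≠ 0 := by
        rintro rfl
        exact hn₁ ⟨h₁.eq_of_zero.symm, rfl⟩
      have hsum : ∑ ρ, (u₁ + u₂) ρ = ∑ ρ, u₁ ρ + ∑ ρ, u₂ ρ := Finset.sum_add_distrib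
      have hpos₁ := sum_pos hu₁
      have hpos₂ := sum_pos hu₂
      obtain ⟨p, hp⟩ := ih _ (by omega) h₂ rfl
      obtain ⟨q, hq⟩ := ih _ (by omega) h₁ rfl
      exact ⟨p.comp q, by rw [Path.lab_comp, hp, hq, add_comm]⟩

lemma exists_path_lab_sub_eq {i j : I} {w : Fin d → ℤ} (hw : w ∈ T.prin)
    (hnonneg : ∀ ρ, 0 ≤ w ρ + (C.D j - C.D i) ρ) :
    ∃ p : C.Path i j, toInt p.lab - (C.D j - C.D i) = w := by
  have hlift : toInt (fun ρ => (w ρ + (C.D j - C.D i) ρ).toNat) = w + (C.D j - C.D i) := by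
    funext ρ
    exact Int.toNat_of_nonneg (hnonneg ρ)
  have hsec : C.IsSection i j (fun ρ => (w ρ + (C.D j - C.D i) ρ).toNat) := by
    rw [IsSection, hlift, add_sub_cancel_right]
    exact hw
  obtain ⟨p, hp⟩ := hsec.exists_path
  exact ⟨p, by rw [hp, hlift, add_sub_cancel_right]⟩

lemma nonempty_path (i j : I) : Nonempty (C.Path i j) := by
  obtain ⟨w, hw, hnonneg⟩ := T.exists_prin_add_nonneg (C.D j - C.D i)
  obtain ⟨p, -⟩ := exists_path_lab_sub_eq (C := C) hw hnonneg
  exact ⟨p⟩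

end Quiver

section SectionMatrix
variable (k : Type) [Field k] {n d : ℕ} {T : ToricData n d} {I : Type}
  [DecidableEq I] {C : Collection T I}

/-- The matrix unit of `End_R(⊕ E_i)` given by the section of `Hom(E_i, E_j)` with divisor
of zeroes `u`. -/
noncomputable def sectionMatrix (C : Collection T I) (i j : I) (u : Fin d → ℕ) :
    Matrix I I (AddMonoidAlgebra k (Fin d → ℤ)) :=
  Matrix.single j i (AddMonoidAlgebra.single (toInt u - (C.D j - C.D i)) 1)

lemma sectionMatrix_self_zero (i : I) : sectionMatrix k C i i 0 = Matrix.single i i 1 := by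
  simp [sectionMatrix, toInt_zero, AddMonoidAlgebra.one_def]

end SectionMatrix

section Algebra
variable (k : Type) [Field k] {n d : ℕ} {T : ToricData n d} {I : Type}
  [Fintype I] {C : Collection T I}

/-- The class in the toric algebra of a path. -/
noncomputable def pathClass {i j : I} (p : C.Path i j) : toricAlgebra k C :=
  RingQuot.mkAlgHom k (PathAlgRel k C) (pathElem k p)

lemma pathClass_eq_of_lab_eq {i j : I} {p q : C.Path i j} (h : p.lab = q.lab) :
    pathClass k p = pathClass k q :=
  RingQuot.mkAlgHom_rel k (.labelEq p q h)

lemma vertex_mul_pathClass {i j : I} (p : C.Path i j) :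
    RingQuot.mkAlgHom k (PathAlgRel k C) (FreeAlgebra.ι k (Sum.inl j)) * pathClass k p
      = pathClass k p := by
  cases p with
  | nil => exact (map_mul _ _ _).symm.trans (RingQuot.mkAlgHom_rel k (.idem i))
  | cons p a h =>
    simp only [pathClass, pathElem, map_mul]
    rw [← mul_assoc, ← map_mul, RingQuot.mkAlgHom_rel k (.hd a)]

lemma vertex_mul_pathClass_of_ne {i j l : I} (p : C.Path i j) (h : l ≠ j) :
    RingQuot.mkAlgHom k (PathAlgRel k C) (FreeAlgebra.ι k (Sum.inl l)) * pathClass k p = 0 := by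
  rw [← vertex_mul_pathClass, ← mul_assoc, ← map_mul, RingQuot.mkAlgHom_rel k (.orth l j h),
    map_zero, zero_mul]

lemma arrow_mul_pathClass_of_ne {i j : I} (p : C.Path i j) (a : C.Arrow) (h : a.src ≠ j) :
    RingQuot.mkAlgHom k (PathAlgRel k C) (FreeAlgebra.ι k (Sum.inr a)) * pathClass k p = 0 := by
  rw [← RingQuot.mkAlgHom_rel k (PathAlgRel.tl a), map_mul, mul_assoc,
    vertex_mul_pathClass_of_ne k p h, mul_zero]

/-- The span of the classes of all paths in the toric algebra. -/
noncomputable def pathSpan (C : Collection T I) : Submodule k (toricAlgebra k C) :=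
  Submodule.span k {x | ∃ (i j : I) (p : C.Path i j), x = pathClass k p}

lemma pathClass_mem_pathSpan {i j : I} (p : C.Path i j) : pathClass k p ∈ pathSpan k C :=
  Submodule.subset_span ⟨i, j, p, rfl⟩

lemma generator_mul_mem_pathSpan (s : I ⊕ C.Arrow) {y : toricAlgebra k C}
    (hy : y ∈ pathSpan k C) :
    RingQuot.mkAlgHom k (PathAlgRel k C) (FreeAlgebra.ι k s) * y ∈ pathSpan k C := by
  induction hy using Submodule.span_induction with
  | mem y hy =>
    obtain ⟨i, j, p, rfl⟩ := hy
    rcases s with l | a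
    · by_cases h : l = j
      · rw [h, vertex_mul_pathClass]
        exact pathClass_mem_pathSpan k p
      · rw [vertex_mul_pathClass_of_ne k p h]
        exact zero_mem _
    · by_cases h : a.src = j
      · have := pathClass_mem_pathSpan k (Path.cons p a h)
        simpa only [pathClass, pathElem, map_mul] using this
      · rw [arrow_mul_pathClass_of_ne k p a h]
        exact zero_mem _
  | zero => simp
  | add y z _ _ hy hz => rw [mul_add]; exact add_mem hy hz
  | smul c y _ hy => rw [mul_smul_comm]; exact Submodule.smul_mem _ _ hy

/-- The toric algebra is spanned by the classes of paths. -/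
lemma pathSpan_eq_top : pathSpan k C = ⊤ := by
  have hmul (x : FreeAlgebra k (I ⊕ C.Arrow)) : ∀ y ∈ pathSpan k C,
      RingQuot.mkAlgHom k (PathAlgRel k C) x * y ∈ pathSpan k C := by
    induction x with
    | grade0 c =>
      intro y hy
      rw [AlgHom.commutes, ← Algebra.smul_def]
      exact Submodule.smul_mem _ _ hy
    | grade1 s => exact fun y hy => generator_mul_mem_pathSpan k s hy
    | mul a b ha hb =>
      intro y hy
      rw [map_mul, mul_assoc]
      exact ha _ (hb _ hy)
    | add a b ha hb =>
      intro y hy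
      rw [map_add, add_mul]
      exact add_mem (ha _ hy) (hb _ hy)
  have hone : (1 : toricAlgebra k C) ∈ pathSpan k C := by
    rw [← map_one (RingQuot.mkAlgHom k (PathAlgRel k C)), ← RingQuot.mkAlgHom_rel k .sum, map_sum]
    exact sum_mem fun i _ => pathClass_mem_pathSpan k (Path.nil i)
  refine eq_top_iff.mpr fun x _ => ?_
  obtain ⟨x, rfl⟩ := RingQuot.mkAlgHom_surjective k (PathAlgRel k C) x
  simpa using hmul x 1 hone

open Classical in
/-- The class of a path from `i` to `j` representing the monomial section with exponent `w`,
and zero if there is none. -/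
noncomputable def monomialClass (C : Collection T I) (j i : I) (w : Fin d → ℤ) :
    toricAlgebra k C :=
  if h : ∃ p : C.Path i j, toInt p.lab - (C.D j - C.D i) = w then pathClass k h.choose else 0

lemma monomialClass_lab {i j : I} (p : C.Path i j) :
    monomialClass k C j i (toInt p.lab - (C.D j - C.D i)) = pathClass k p := by
  have h : ∃ q : C.Path i j,
      toInt q.lab - (C.D j - C.D i) = toInt p.lab - (C.D j - C.D i) := ⟨p, rfl⟩
  rw [monomialClass, dif_pos h]
  exact pathClass_eq_of_lab_eq k (toInt_injective (sub_left_injective h.choose_spec))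

variable [DecidableEq I]

lemma sectionMatrix_mul (i j l : I) (u w : Fin d → ℕ) :
    sectionMatrix k C j l w * sectionMatrix k C i j u = sectionMatrix k C i l (u + w) := by
  simp only [sectionMatrix, Matrix.single_mul_single_same, AddMonoidAlgebra.single_mul_single,
    mul_one, toInt_add]
  congr 2
  abel

lemma sectionMatrix_mem_endAlgebra {i j : I} {u : Fin d → ℕ} (hu : C.IsSection i j u) :
    sectionMatrix k C i j u ∈ endAlgebra k C := by
  intro a b
  by_cases h : j = a ∧ i = b
  · obtain ⟨rfl, rfl⟩ := h
    simp only [sectionMatrix, Matrix.single_apply_same]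
    exact Submodule.subset_span ⟨_, hu, fun ρ => by simp [toInt], rfl⟩
  · rw [sectionMatrix, Matrix.single_apply_of_ne _ _ _ _ _ h]
    exact zero_mem _

/-- The action of the vertices and arrows of the quiver on `⊕ E_i`. -/
noncomputable def generatorMatrix (C : Collection T I) :
    I ⊕ C.Arrow → Matrix I I (AddMonoidAlgebra k (Fin d → ℤ))
  | .inl i => sectionMatrix k C i i 0
  | .inr a => sectionMatrix k C a.src a.tgt a.lab

lemma lift_pathElem {i j : I} (p : C.Path i j) :
    FreeAlgebra.lift k (generatorMatrix k C) (pathElem k p) = sectionMatrix k C i j p.lab := by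
  induction p with
  | nil => simp [pathElem, Path.lab, generatorMatrix]
  | cons p a h ih =>
    subst h
    rw [pathElem, map_mul, ih, FreeAlgebra.lift_ι_apply, generatorMatrix, sectionMatrix_mul,
      Path.lab]

lemma lift_eq_of_pathAlgRel {x y : FreeAlgebra k (I ⊕ C.Arrow)} (h : PathAlgRel k C x y) :
    FreeAlgebra.lift k (generatorMatrix k C) x = FreeAlgebra.lift k (generatorMatrix k C) y := by
  cases h with
  | orth i j h =>
    simp [generatorMatrix, sectionMatrix_self_zero, Matrix.single_mul_single_of_ne _ _ _ _ h]
  | idem i => simp [generatorMatrix, sectionMatrix_mul]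
  | sum => simp [generatorMatrix, sectionMatrix_self_zero, Matrix.sum_single_one]
  | hd a => simp [generatorMatrix, sectionMatrix_mul]
  | tl a => simp [generatorMatrix, sectionMatrix_mul]
  | labelEq p q h => rw [lift_pathElem, lift_pathElem, h]

/-- The representation of the toric algebra on `⊕ E_i`. -/
noncomputable def toMatrix (C : Collection T I) :
    toricAlgebra k C →ₐ[k] Matrix I I (AddMonoidAlgebra k (Fin d → ℤ)) :=
  RingQuot.liftAlgHom k
    ⟨FreeAlgebra.lift k (generatorMatrix k C), fun _ _ => lift_eq_of_pathAlgRel k⟩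

lemma toMatrix_pathClass {i j : I} (p : C.Path i j) :
    toMatrix k C (pathClass k p) = sectionMatrix k C i j p.lab := by
  rw [toMatrix, pathClass, RingQuot.liftAlgHom_mkAlgHom_apply, lift_pathElem]

/-- A linear left inverse of `toMatrix`. -/
noncomputable def ofMatrix (C : Collection T I) :
    Matrix I I (AddMonoidAlgebra k (Fin d → ℤ)) →ₗ[k] toricAlgebra k C :=
  Matrix.liftLinear k fun j i =>
    Finsupp.linearCombination k (monomialClass k C j i) ∘ₗ
      (AddMonoidAlgebra.coeffLinearEquiv k).toLinearMap

lemma ofMatrix_toMatrix (x : toricAlgebra k C) : ofMatrix k C (toMatrix k C x) = x := by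
  have hx : x ∈ pathSpan k C := by simp [pathSpan_eq_top]
  induction hx using Submodule.span_induction with
  | mem x hx =>
    obtain ⟨i, j, p, rfl⟩ := hx
    simp [toMatrix_pathClass, ofMatrix, sectionMatrix, monomialClass_lab]
  | zero => simp
  | add x y _ _ hx hy => rw [map_add, map_add, hx, hy]
  | smul c x _ hx => rw [map_smul, map_smul, hx]

lemma range_toMatrix : (toMatrix k C).range = endAlgebra k C := by
  apply le_antisymm
  · rintro _ ⟨x, rfl⟩
    have hx : x ∈ pathSpan k C := by simp [pathSpan_eq_top]
    change toMatrix k C x ∈ endAlgebra k C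
    induction hx using Submodule.span_induction with
    | mem x hx =>
      obtain ⟨i, j, p, rfl⟩ := hx
      rw [toMatrix_pathClass]
      exact sectionMatrix_mem_endAlgebra k p.isSection
    | zero => rw [map_zero]; exact zero_mem _
    | add x y _ _ hx hy => rw [map_add]; exact add_mem hx hy
    | smul c x _ hx => rw [map_smul]; exact Subalgebra.smul_mem _ hx c
  · intro m hm
    have hsingle (j i : I) {f : AddMonoidAlgebra k (Fin d → ℤ)}
        (hf : f ∈ Submodule.span k (secSet k T (C.D j - C.D i))) :
        Matrix.single j i f ∈ (toMatrix k C).range := by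
      induction hf using Submodule.span_induction with
      | mem f hf =>
        obtain ⟨w, hw, hnonneg, rfl⟩ := hf
        obtain ⟨p, hp⟩ := exists_path_lab_sub_eq (C := C) hw hnonneg
        exact ⟨pathClass k p, by rw [← hp]; exact toMatrix_pathClass k p⟩
      | zero => rw [Matrix.single_zero]; exact zero_mem _
      | add f g _ _ hf hg => rw [Matrix.single_add]; exact add_mem hf hg
      | smul c f _ hf => rw [← Matrix.smul_single]; exact Subalgebra.smul_mem _ hf c
    rw [Matrix.matrix_eq_sum_single m]
    exact sum_mem fun j _ => sum_mem fun i _ => hsingle j i (hm j i)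

/-- The toric algebra of a collection is the endomorphism algebra `End_R(⊕ E_i)`. -/
noncomputable def toricAlgebraEquiv (C : Collection T I) :
    toricAlgebra k C ≃ₐ[k] endAlgebra k C :=
  (AlgEquiv.ofInjective (toMatrix k C)
    (Function.LeftInverse.injective (ofMatrix_toMatrix k))).trans
    (Subalgebra.equivOfEq _ _ (range_toMatrix k))

/-- The action of `R` on `⊕ E_i`. -/
noncomputable def scalarEnd (C : Collection T I) : coordRing k T →ₐ[k] endAlgebra k C :=
  ((IsScalarTower.toAlgHom k (AddMonoidAlgebra k (Fin d → ℤ))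
    (Matrix I I (AddMonoidAlgebra k (Fin d → ℤ)))).comp (coordRing k T).val).codRestrict _ <| by
    intro f i j
    have hf : (f : AddMonoidAlgebra k (Fin d → ℤ)) ∈ Submodule.span k (secSet k T 0) := f.2
    by_cases h : i = j
    · subst h
      simpa [Matrix.algebraMap_matrix_apply] using hf
    · simp [Matrix.algebraMap_matrix_apply, h]

lemma coe_scalarEnd (f : coordRing k T) : (scalarEnd k C f).1 =
    algebraMap (AddMonoidAlgebra k (Fin d → ℤ)) _ (f : AddMonoidAlgebra k (Fin d → ℤ)) :=
  rfl

lemma scalarEnd_mem_center (f : coordRing k T) :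
    scalarEnd k C f ∈ Subalgebra.center k (endAlgebra k C) := by
  rw [Subalgebra.mem_center_iff]
  intro m
  apply Subtype.ext
  rw [Subalgebra.coe_mul, Subalgebra.coe_mul, coe_scalarEnd]
  exact (Algebra.commutes _ _).symm

lemma scalarEnd_injective [Nonempty I] : Function.Injective (scalarEnd k C) := by
  intro f g h
  have h := congrArg Subtype.val h
  rw [coe_scalarEnd, coe_scalarEnd] at h
  exact Subtype.ext (FaithfulSMul.algebraMap_injective _ _ h)

/-- Central endomorphisms of `⊕ E_i` are given by the action of `R`. -/
lemma exists_scalarEnd_eq_of_mem_center [Nonempty I] {m : endAlgebra k C}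
    (hm : m ∈ Subalgebra.center k (endAlgebra k C)) : ∃ f, scalarEnd k C f = m := by
  rw [Subalgebra.mem_center_iff] at hm
  have hcomm {i j : I} (p : C.Path i j) : sectionMatrix k C i j p.lab * m.1 =
      m.1 * sectionMatrix k C i j p.lab :=
    congrArg Subtype.val (hm ⟨_, sectionMatrix_mem_endAlgebra k p.isSection⟩)
  have hoff (i j : I) (h : i ≠ j) : m.1 i j = 0 := by
    have := congrFun (congrFun (hcomm (Path.nil i)) i) j
    simpa [Path.lab, sectionMatrix_self_zero, h.symm] using this
  have hdiag (i j : I) : m.1 i i = m.1 j j := by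
    obtain ⟨p⟩ := nonempty_path (C := C) i j
    have := congrFun (congrFun (hcomm p) j) i
    simp only [sectionMatrix, Matrix.single_mul_apply_same, Matrix.mul_single_apply_same] at this
    have := congrArg (AddMonoidAlgebra.single (-(toInt p.lab - (C.D j - C.D i))) (1 : k) * ·) this
    simp only [mul_comm (m.1 j j)] at this
    simpa only [← mul_assoc, AddMonoidAlgebra.single_mul_single, neg_add_cancel, mul_one,
      ← AddMonoidAlgebra.one_def, one_mul] using this
  obtain ⟨i₀⟩ := ‹Nonempty I›
  have hmem : m.1 i₀ i₀ ∈ coordRing k T := by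
    have := m.2 i₀ i₀
    rwa [sub_self] at this
  refine ⟨⟨_, hmem⟩, Subtype.ext ?_⟩
  ext1 i j
  rw [coe_scalarEnd, Matrix.algebraMap_matrix_apply]
  split_ifs with h
  · subst h
    exact hdiag i₀ i
  · exact (hoff i j h).symm

/-- The centre of `End_R(⊕ E_i)` is `R`. -/
noncomputable def coordRingEquivCenter [Nonempty I] (C : Collection T I) :
    coordRing k T ≃ₐ[k] Subalgebra.center k (endAlgebra k C) :=
  AlgEquiv.ofBijective ((scalarEnd k C).codRestrict _ (scalarEnd_mem_center k))
    ⟨fun _ _ h => scalarEnd_injective k (congrArg Subtype.val h), fun m => by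
      obtain ⟨f, hf⟩ := exists_scalarEnd_eq_of_mem_center k m.2
      exact ⟨f, Subtype.ext hf⟩⟩

end Algebra
end Collection

/-- Isomorphic algebras have isomorphic centres. -/
def centerAlgEquiv {k A B : Type*} [CommRing k] [Ring A] [Ring B] [Algebra k A] [Algebra k B]
    (e : A ≃ₐ[k] B) : Subalgebra.center k A ≃ₐ[k] Subalgebra.center k B :=
  AlgEquiv.ofRingEquiv (f := Subring.centerCongr e.toRingEquiv) fun c =>
    Subtype.ext (e.commutes c)

end NCCell

open NCCell Collection

/-- Lemma 2.5: for any collection `𝓔 = (E_0, …, E_r)` of distinct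
rank one reflexive sheaves on `X`, the quiver of sections `Q` of `𝓔` is strongly
connected, the toric algebra `A_𝓔 = kQ/J_𝓔` is isomorphic as a `k`-algebra to
`End_R(⊕_{i ∈ Q₀} E_i)`, and the centre `Z(A_𝓔)` is isomorphic to `R`. -/
theorem toric_algebra_eq_endomorphism_algebra
    (k : Type) [Field k] [IsAlgClosed k]
    {n d : ℕ} (T : ToricData n d) {r : ℕ}
    (C : Collection T (Fin (r + 1))) (hD₀ : C.D 0 = 0) :
    (∀ i j : Fin (r + 1), Nonempty (C.Path i j))
    ∧ Nonempty (toricAlgebra k C ≃ₐ[k] ↥(endAlgebra k C))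
    ∧ Nonempty (↥(Subalgebra.center k (toricAlgebra k C)) ≃ₐ[k] ↥(coordRing k T)) := by
  exact ⟨fun i j => nonempty_path i j, ⟨toricAlgebraEquiv k C⟩,
    ⟨(centerAlgEquiv (toricAlgebraEquiv k C)).trans (coordRingEquivCenter k C).symm⟩⟩
end

section
/- The image of the cone C = {v ∈ ℤ(Q)^∨ ⊗ ℝ : ⟨u, v⟩ ≥ 0 for all u ∈ ℕ(Q)} under the map ψ*: ℤ(Q)^∨ ⊗ ℝ → N ⊗ ℝ is the cone σ. -/
namespace NCCell
namespace Collection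
section
variable {n d : ℕ} {T : ToricData n d} {I : Type*} [DecidableEq I] (C : Collection T I)

/-- The value `π(χ_a) = (χ_{h(a)} - χ_{t(a)}, div a)` of the map
`π = (inc, div) : ℤ^{Q₁} → Wt(Q) ⊕ ℤᵈ` on the characteristic function of an arrow. -/
def piGen (a : C.Arrow) : (I → ℤ) × (Fin d → ℤ) :=
  (fun i => (if i = a.tgt then 1 else 0) - (if i = a.src then 1 else 0), toInt a.lab)

/-- The lattice `ℤ(Q) = π(ℤ^{Q₁})`, realised as the subgroup of `ℤ^{Q₀} ⊕ ℤᵈ`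
generated by the vectors `π(χ_a)`. -/
def latZQ : AddSubgroup ((I → ℤ) × (Fin d → ℤ)) :=
  AddSubgroup.closure (Set.range C.piGen)

/-- The semigroup `ℕ(Q) = π(ℕ^{Q₁})`, realised as the subsemigroup of `ℤ^{Q₀} ⊕ ℤᵈ`
generated by the vectors `π(χ_a)`. -/
def semiNQ : AddSubmonoid ((I → ℤ) × (Fin d → ℤ)) :=
  AddSubmonoid.closure (Set.range C.piGen)

end
end Collection
end NCCell

namespace NCCell
namespace Collection
variable {n d : ℕ} {T : ToricData n d} {I : Type*} [DecidableEq I] (C : Collection T I)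

/-- The real vector `π(χ_a) ⊗ ℝ` in the ambient space `(ℝ^{Q₀} × ℝᵈ)` of `ℤ(Q) ⊗ ℝ`. -/
def piGenR (a : C.Arrow) : (I → ℝ) × (Fin d → ℝ) :=
  (fun i => (if i = a.tgt then 1 else 0) - (if i = a.src then 1 else 0),
    fun ρ => (a.lab ρ : ℝ))

end Collection
end NCCell

open NCCell Collection

namespace NCCell

/-- A linear functional that is nonnegative on the arrows is nonnegative on every
torus-invariant section. -/
theorem Collection.nonneg_of_isSection {n d : ℕ} {T : ToricData n d} {I : Type*} [DecidableEq I]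
    (C : Collection T I) (φ : ((I → ℝ) × (Fin d → ℝ)) →ₗ[ℝ] ℝ)
    (hφ : ∀ a : C.Arrow, 0 ≤ φ (C.piGenR a)) (i j : I) (u : Fin d → ℕ)
    (hu : C.IsSection i j u) :
    0 ≤ φ (fun k => (if k = j then 1 else 0) - (if k = i then 1 else 0),
      fun ρ => (u ρ : ℝ)) := by
  have eq_of_zero : ∀ i j, C.IsSection i j 0 → i = j := by
    intro i j h
    apply C.distinct
    have : toInt (0 : Fin d → ℕ) - (C.D j - C.D i) = C.D i - C.D j := by
      funext ρ; simp [toInt]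
    rwa [Collection.IsSection, this] at h
  induction hs : ∑ ρ, u ρ using Nat.strong_induction_on generalizing i j u with
  | _ s ih =>
  by_cases hu0 : u = 0
  · subst hu0
    obtain rfl := eq_of_zero i j hu
    apply le_of_eq
    rw [← map_zero φ]
    congr 1
    ext <;> simp
  by_cases hirr : C.IsIrreducible i j u
  · exact hφ ⟨i, j, u, hirr, fun h => hu0 h.2⟩
  · simp only [Collection.IsIrreducible, hu, true_and, not_forall, not_or] at hirr
    obtain ⟨l, u₁, u₂, rfl, h₂, h₁, hn₂, hn₁⟩ := hirr
    have pos : ∀ w : Fin d → ℕ, w ≠ 0 → 0 < ∑ ρ, w ρ := by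
      intro w hw
      rw [Nat.pos_iff_ne_zero]
      contrapose! hw
      funext ρ
      simpa using Finset.sum_eq_zero_iff.mp hw ρ (Finset.mem_univ ρ)
    have p₁ := pos u₁ (by
      rintro rfl
      exact hn₁ ⟨eq_of_zero _ _ h₁, rfl⟩)
    have p₂ := pos u₂ (by
      rintro rfl
      exact hn₂ ⟨(eq_of_zero _ _ h₂).symm, rfl⟩)
    simp only [Pi.add_apply, Finset.sum_add_distrib] at hs
    have key := add_nonneg (ih _ (by omega) i l u₂ h₂ rfl) (ih _ (by omega) l j u₁ h₁ rfl)
    rw [← map_add] at key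
    refine key.trans_eq (congrArg φ (Prod.ext ?_ ?_))
    · funext k
      simp
    · funext ρ
      simp [add_comm]

/-- A real vector outside the cone generated by integral vectors lying in an open half-space is
separated from it by an integral vector. -/
theorem exists_int_separating {n d : ℕ} (v : Fin d → Fin n → ℤ)
    (hv : ∃ u : Fin n → ℤ, ∀ ρ, 0 < ∑ i, u i * v ρ i) (x : Fin n → ℝ)
    (hx : ¬ ∃ c : Fin d → ℝ, (∀ ρ, 0 ≤ c ρ) ∧ x = fun i => ∑ ρ, c ρ * (v ρ i : ℝ)) :
    ∃ u : Fin n → ℤ, (∀ ρ, 0 ≤ ∑ i, u i * v ρ i) ∧ ∑ i, (u i : ℝ) * x i < 0 := by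
  obtain ⟨u₀, hu₀⟩ := hv
  have hx0 : x ≠ 0 := by
    rintro rfl
    exact hx ⟨0, fun _ => le_rfl, by funext i; simp⟩
  let L : (Fin d → ℝ) →ₗ[ℝ] (Fin n → ℝ) := Fintype.linearCombination ℝ fun ρ i => (v ρ i : ℝ)
  have hL : ∀ c i, L c i = ∑ ρ, c ρ * (v ρ i : ℝ) := by
    intro c i
    simp [L, Fintype.linearCombination_apply]
  have hdisj : Disjoint (L '' stdSimplex ℝ (Fin d)) ((fun t : ℝ => t • x) '' Set.Ici 0) := by
    rw [Set.disjoint_left]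
    rintro _ ⟨c, ⟨hc, hc1⟩, rfl⟩ ⟨t, ht, hte⟩
    have hte' : ∀ i, t * x i = ∑ ρ, c ρ * (v ρ i : ℝ) := by
      intro i
      rw [← hL, ← hte]
      simp
    rcases (Set.mem_Ici.mp ht).eq_or_lt with rfl | htpos
    · have h0 : ∑ ρ, c ρ * (∑ i, u₀ i * v ρ i : ℤ) = 0 := by
        calc ∑ ρ, c ρ * ((∑ i, u₀ i * v ρ i : ℤ) : ℝ)
            = ∑ i, (u₀ i : ℝ) * ∑ ρ, c ρ * (v ρ i : ℝ) := by
              push_cast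
              simp only [Finset.mul_sum]
              rw [Finset.sum_comm]
              exact Finset.sum_congr rfl fun _ _ => Finset.sum_congr rfl fun _ _ => by ring
          _ = 0 := by simp [← hte']
      have hpos : ∀ ρ, (0 : ℝ) < (∑ i, u₀ i * v ρ i : ℤ) := fun ρ => by exact_mod_cast hu₀ ρ
      rw [Finset.sum_eq_zero_iff_of_nonneg
        fun ρ _ => mul_nonneg (hc ρ) (hpos ρ).le] at h0
      have : ∀ ρ, c ρ = 0 := fun ρ =>
        (mul_eq_zero.mp (h0 ρ (Finset.mem_univ ρ))).resolve_right (hpos ρ).ne'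
      simp [this] at hc1
    · refine hx ⟨fun ρ => t⁻¹ * c ρ, fun ρ => mul_nonneg (inv_nonneg.mpr htpos.le) (hc ρ), ?_⟩
      funext i
      simp only [mul_assoc, ← Finset.mul_sum, ← hte']
      field_simp
  obtain ⟨f, s, t, hfs, hst, hft⟩ := geometric_hahn_banach_compact_closed
    ((convex_stdSimplex ℝ (Fin d)).linear_image L)
    ((isCompact_stdSimplex ℝ (Fin d)).image L.continuous_of_finiteDimensional)
    ((convex_Ici (0 : ℝ)).linear_image (LinearMap.toSpanSingleton ℝ _ x))
    (isClosedMap_smul_left x _ isClosed_Ici) hdisj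
  have hf : ∀ y, f y = ∑ i, f (Pi.single i 1) * y i := by
    intro y
    conv_lhs => rw [← Finset.univ_sum_single y]
    rw [map_sum]
    refine Finset.sum_congr rfl fun i _ => ?_
    have : (Pi.single i (y i) : Fin n → ℝ) = y i • Pi.single i 1 := by
      rw [← Pi.single_smul]; simp
    rw [this, map_smul, smul_eq_mul, mul_comm]
  have hs0 : t < 0 := by simpa using hft 0 ⟨0, by simp⟩
  have hfv : ∀ ρ, f (fun i => (v ρ i : ℝ)) < 0 := by
    intro ρ
    refine (hfs _ ⟨Pi.single ρ 1, single_mem_stdSimplex ℝ ρ, ?_⟩).trans (hst.trans hs0)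
    simp [L]
  have hfx : 0 ≤ f x := by
    by_contra! hneg
    have := hft ((t / f x) • x) ⟨t / f x, (div_pos_of_neg_of_neg hs0 hneg).le, rfl⟩
    rw [map_smul, smul_eq_mul, div_mul_cancel₀ _ hneg.ne] at this
    exact lt_irrefl _ this
  -- The open set of strictly separating functionals is nonempty, hence has a rational point.
  let U : Set (Fin n → ℝ) := {w | (∀ ρ, 0 < ∑ i, w i * (v ρ i : ℝ)) ∧ ∑ i, w i * x i < 0}
  have hUo : IsOpen U := by
    refine IsOpen.inter (s := {w : Fin n → ℝ | ∀ ρ, 0 < ∑ i, w i * (v ρ i : ℝ)})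
      (t := {w | ∑ i, w i * x i < 0}) ?_ ?_
    · rw [Set.ofPred_forall]
      exact isOpen_iInter_of_finite fun ρ => isOpen_lt (by fun_prop) (by fun_prop)
    · exact isOpen_lt (by fun_prop) (by fun_prop)
  have hxx : 0 < ∑ i, x i * x i := by
    obtain ⟨i, hi⟩ := Function.ne_iff.mp hx0
    exact Finset.sum_pos' (fun i _ => mul_self_nonneg _)
      ⟨i, Finset.mem_univ i, mul_self_pos.mpr hi⟩
  have hUne : U.Nonempty := by
    have hsmall : ∀ᶠ ε : ℝ in nhdsWithin 0 (Set.Ioi 0),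
        ∀ ρ, 0 < -f (fun i => (v ρ i : ℝ)) - ε * ∑ i, x i * (v ρ i : ℝ) := by
      refine Filter.eventually_all.mpr fun ρ => nhdsWithin_le_nhds ?_
      refine ContinuousAt.eventually_lt (by fun_prop) (by fun_prop) ?_
      simpa using hfv ρ
    obtain ⟨ε, hε, hε0⟩ := (hsmall.and self_mem_nhdsWithin).exists
    have hexp : ∀ y : Fin n → ℝ, ∑ i, (-f (Pi.single i 1) - ε * x i) * y i
        = -f y - ε * ∑ i, x i * y i := by
      intro y
      rw [hf y]
      simp only [sub_mul, Finset.sum_sub_distrib, neg_mul, Finset.sum_neg_distrib, mul_assoc,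
        Finset.mul_sum]
    refine ⟨fun i => -f (Pi.single i 1) - ε * x i, fun ρ => ?_, ?_⟩
    · rw [hexp]
      exact hε ρ
    · rw [hexp]
      have := mul_pos (Set.mem_Ioi.mp hε0) hxx
      linarith
  obtain ⟨q, hq, hqx⟩ := (DenseRange.piMap fun _ : Fin n => Rat.denseRange_cast (𝕜 := ℝ)
    ).exists_mem_open hUo hUne
  have hden : ∀ i, ∃ m : ℤ, (m : ℝ) = (∏ j, (q j).den : ℕ) * (q i : ℝ) := by
    intro i
    obtain ⟨k, hk⟩ := Finset.dvd_prod_of_mem (fun j => (q j).den) (Finset.mem_univ i)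
    refine ⟨k * (q i).num, ?_⟩
    have hqi : ((q i).den : ℝ) * (q i : ℝ) = (q i).num := by
      exact_mod_cast Rat.den_mul_eq_num (q i)
    rw [hk]
    push_cast
    rw [← hqi]
    ring
  choose u hu using hden
  have hN : (0 : ℝ) < (∏ j, (q j).den : ℕ) := by
    exact_mod_cast Finset.prod_pos fun j _ => (q j).den_pos
  refine ⟨u, fun ρ => ?_, ?_⟩
  · have h := mul_pos hN (hq ρ)
    simp only [Finset.mul_sum, ← mul_assoc, Pi.map_apply, ← hu] at h
    exact_mod_cast h.le
  · have h := mul_neg_of_pos_of_neg hN hqx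
    simpa only [Finset.mul_sum, ← mul_assoc, Pi.map_apply, ← hu] using h

end NCCell

/-- Lemma 2.11: the image of the cone
`C = {v ∈ ℤ(Q)^∨ ⊗ ℝ : ⟨u,v⟩ ≥ 0 for all u ∈ ℕ(Q)}` under the map
`ψ* : ℤ(Q)^∨ ⊗ ℝ → N ⊗ ℝ` dual to `ψ : M → ℤ(Q)`, `u ↦ (0, ι u)`, is the cone `σ`.
Functionals on `ℤ(Q) ⊗ ℝ` are represented by (restrictions of) linear functionals `φ`
on the ambient space `ℝ^{Q₀} × ℝᵈ` (every functional extends), membership in `C` is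
nonnegativity on the generators `π(χ_a)` of `ℕ(Q)`, and `ψ*(φ) ∈ N ⊗ ℝ = ℝⁿ` is
`i ↦ φ(ψ(e_i)) = φ(0, (v_ρ(i))_ρ)`; the cone `σ ⊆ ℝⁿ` is the set of nonnegative
combinations of the ray generators `v_ρ`. -/
theorem image_of_dual_cone_eq_sigma
    {n d : ℕ} (T : ToricData n d) {r : ℕ}
    (C : Collection T (Fin (r + 1))) (hD₀ : C.D 0 = 0) :
    {x : Fin n → ℝ | ∃ φ : ((Fin (r + 1) → ℝ) × (Fin d → ℝ)) →ₗ[ℝ] ℝ,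
        (∀ a : C.Arrow, 0 ≤ φ (C.piGenR a)) ∧
        x = fun i => φ (0, fun ρ => (T.v ρ i : ℝ))}
      = {x : Fin n → ℝ | ∃ c : Fin d → ℝ, (∀ ρ, 0 ≤ c ρ) ∧
          x = fun i => ∑ ρ, c ρ * (T.v ρ i : ℝ)} := by
  apply Set.Subset.antisymm
  · rintro x ⟨φ, hφ, rfl⟩
    by_contra hx
    obtain ⟨u, hu, hux⟩ := exists_int_separating T.v T.strongly_convex _ hx
    let w : Fin d → ℕ := fun ρ => (∑ i, u i * T.v ρ i).toNat
    have hw : ∀ ρ, (w ρ : ℤ) = ∑ i, u i * T.v ρ i := fun ρ => Int.toNat_of_nonneg (hu ρ)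
    have hsec : C.IsSection 0 0 w := ⟨u, by
      funext ρ
      simp [toInt, hw, ToricData.iota]⟩
    refine (C.nonneg_of_isSection φ hφ 0 0 w hsec).not_gt (lt_of_eq_of_lt ?_ hux)
    simp only [← smul_eq_mul, ← map_smul, ← map_sum]
    congr 1
    ext ρ
    · simp [Prod.fst_sum]
    · have : (w ρ : ℝ) = ∑ i, (u i : ℝ) * (T.v ρ i : ℝ) := by exact_mod_cast hw ρ
      simp [Prod.snd_sum, this]
  · rintro x ⟨c, hc, rfl⟩
    refine ⟨(Fintype.linearCombination ℝ c).comp (LinearMap.snd ℝ _ _), fun a => ?_, ?_⟩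
    · simp only [LinearMap.comp_apply, LinearMap.snd_apply, Fintype.linearCombination_apply,
        piGenR, smul_eq_mul]
      exact Finset.sum_nonneg fun ρ _ => mul_nonneg (Nat.cast_nonneg _) (hc ρ)
    · funext i
      simp [Fintype.linearCombination_apply, mul_comm]
end

section
/- For the McKay collection E = (E_ρ : ρ ∈ G*), the toric algebra A_E is isomorphic to the skew group algebra k[x₁,…,x_n] ∗ G. -/
namespace NCCell

/-- Generators of the path algebra `kQ` of the McKay quiver of a finite abelian
diagonal group with character group `H`: the trivial paths `e ρ` at the vertices
`ρ ∈ H`, and the arrows `a i ρ : ρ·χ i → ρ` (labelled `x_i`). -/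
inductive McKayGen (H : Type) (n : ℕ)
  | e : H → McKayGen H n
  | a : Fin n → H → McKayGen H n

open FreeAlgebra McKayGen in
/-- The relations presenting the McKay toric algebra `A_𝓔 = kQ/J_𝓔`: the path algebra
relations for the idempotents `e ρ` and the arrows `a i ρ` (composition is written
right-to-left), together with the relations `a_i^{ρρ_j} a_j^ρ = a_j^{ρρ_i} a_i^ρ`
generating `J_𝓔`. -/
inductive McKayRel (k : Type) [CommRing k] (H : Type) [CommGroup H] [Fintype H]
    (n : ℕ) (χ : Fin n → H) :
    FreeAlgebra k (McKayGen H n) → FreeAlgebra k (McKayGen H n) → Prop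
  | orth (ρ τ : H) (h : ρ ≠ τ) : McKayRel k H n χ (ι k (e ρ) * ι k (e τ)) 0
  | idem (ρ : H) : McKayRel k H n χ (ι k (e ρ) * ι k (e ρ)) (ι k (e ρ))
  | sum : McKayRel k H n χ (∑ ρ : H, ι k (e ρ)) 1
  | hd (i : Fin n) (ρ : H) :
      McKayRel k H n χ (ι k (e ρ) * ι k (a i ρ)) (ι k (a i ρ))
  | tl (i : Fin n) (ρ : H) :
      McKayRel k H n χ (ι k (a i ρ) * ι k (e (ρ * χ i))) (ι k (a i ρ))
  | comm (i j : Fin n) (ρ : H) :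
      McKayRel k H n χ (ι k (a j ρ) * ι k (a i (ρ * χ j)))
        (ι k (a i ρ) * ι k (a j (ρ * χ i)))

/-- The McKay toric algebra `A_𝓔 = kQ/J_𝓔` of the collection `𝓔 = (E_ρ : ρ ∈ G*)` on
`X = 𝔸ⁿ/G`, presented by the quiver of sections (= the McKay quiver) and its
relations. -/
abbrev McKayAlgebra (k : Type) [CommRing k] (H : Type) [CommGroup H] [Fintype H]
    (n : ℕ) (χ : Fin n → H) :=
  RingQuot (McKayRel k H n χ)

/-- The skew group algebra `k[x₁,…,x_n] ∗ G`, realised concretely (using that the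
action of `G = Hom(G*, kˣ)` on `k[x₁,…,x_n]` is faithful and `char k ∤ |G|`) as the
subalgebra of `End_k(k[x₁,…,x_n])` generated by multiplication by the `x_i` together
with the `k`-algebra automorphisms given by the elements `g ∈ G`, which act by
`g · x_i = g(χ i) x_i`; the products `f·g` then multiply by
`(f·g)(f'·g') = (f g(f'))·(gg')`, and the `f·g` with `f` a monomial and `g ∈ G` form a
`k`-basis. -/
noncomputable def SkewGroupAlgebra (k : Type) [Field k] (H : Type) [CommGroup H]
    (n : ℕ) (χ : Fin n → H) : Subalgebra k (Module.End k (MvPolynomial (Fin n) k)) :=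
  Algebra.adjoin k
    ({f | ∃ i : Fin n, f = LinearMap.mulLeft k (MvPolynomial.X i)} ∪
     {f | ∃ g : H →* kˣ, f =
        (MvPolynomial.aeval fun i : Fin n => ((g (χ i) : k) • MvPolynomial.X i :
          MvPolynomial (Fin n) k)).toLinearMap})

end NCCell

open NCCell

namespace NCCell

open MvPolynomial

section General

open scoped IsMulCommutative in
/-- A family of pairwise commuting elements of an algebra is the image of the variables under an
algebra homomorphism out of the polynomial ring. -/
lemma exists_algHom_X_eq {k A σ : Type*} [CommRing k] [Ring A] [Algebra k A] (x : σ → A)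
    (hx : ∀ i j, x i * x j = x j * x i) :
    ∃ Y : MvPolynomial σ k →ₐ[k] A, ∀ i, Y (X i) = x i := by
  have hcomm : ∀ a ∈ Set.range x, ∀ b ∈ Set.range x, a * b = b * a := by
    rintro _ ⟨i, rfl⟩ _ ⟨j, rfl⟩
    exact hx i j
  have := Algebra.isMulCommutative_adjoin k hcomm
  exact ⟨(Algebra.adjoin k (Set.range x)).val.comp
    (aeval (R := k) (S₁ := Algebra.adjoin k (Set.range x))
      fun i => ⟨x i, Algebra.subset_adjoin ⟨i, rfl⟩⟩), fun i => by simp⟩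

/-- Column orthogonality for the characters of a finite abelian group. -/
lemma sum_monoidHom_apply (k H : Type*) [Field k] [IsAlgClosed k] [CommGroup H] [Fintype H]
    [Fintype (H →* kˣ)] [DecidableEq H] (hchar : (Fintype.card H : k) ≠ 0) (h : H) :
    ∑ g : H →* kˣ, (g h : k) = if h = 1 then (Fintype.card H : k) else 0 := by
  have : NeZero (Monoid.exponent H : k) := ⟨fun h0 => hchar <| by
    obtain ⟨c, hc⟩ := Group.exponent_dvd_card (G := H)
    rw [hc, Nat.cast_mul, h0, zero_mul]⟩
  split_ifs with hh
  · have hcard := CommGroup.card_monoidHom_of_hasEnoughRootsOfUnity H k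
    rw [Nat.card_eq_fintype_card, Nat.card_eq_fintype_card] at hcard
    simp [hh, hcard]
  · obtain ⟨g₀, hg₀⟩ := CommGroup.exists_apply_ne_one_of_hasEnoughRootsOfUnity H k hh
    have hmul : (g₀ h : k) * ∑ g : H →* kˣ, (g h : k) = ∑ g : H →* kˣ, (g h : k) := by
      rw [Finset.mul_sum]
      exact Fintype.sum_equiv (Equiv.mulLeft g₀) _ _ fun g => by simp
    by_contra hne
    exact hg₀ (Units.ext ((mul_eq_right₀ hne).1 hmul))

lemma end_ext_monomial {k σ : Type*} [CommRing k] {S T : Module.End k (MvPolynomial σ k)}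
    (h : ∀ u, S (monomial u 1) = T (monomial u 1)) : S = T :=
  (basisMonomials σ k).ext fun u => by simpa using h u

end General

section Weight

variable {H : Type} [CommGroup H] {n : ℕ} (χ : Fin n → H)

/-- The degree of the monomial `x^u` for the grading with `deg x_i = χ i`. -/
def weight (u : Fin n →₀ ℕ) : H := ∏ i, χ i ^ u i

lemma weight_add (u v : Fin n →₀ ℕ) : weight χ (u + v) = weight χ u * weight χ v := by
  simp [weight, pow_add, Finset.prod_mul_distrib]

lemma weight_single (i : Fin n) : weight χ (Finsupp.single i 1) = χ i := by
  classical
  simp [weight, Finsupp.single_apply]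

lemma weight_nsmul (N : ℕ) (u : Fin n →₀ ℕ) : weight χ (N • u) = weight χ u ^ N := by
  simp [weight, Finset.prod_pow, pow_mul']

lemma weight_surjective [Fintype H] (hgen : Subgroup.closure (Set.range χ) = ⊤) :
    Function.Surjective (weight χ) := by
  intro h
  have hh : h ∈ Subgroup.closure (Set.range χ) := hgen ▸ Subgroup.mem_top h
  induction hh using Subgroup.closure_induction with
  | mem x hx =>
    obtain ⟨i, rfl⟩ := hx
    exact ⟨_, weight_single χ i⟩
  | one => exact ⟨0, by simp [weight]⟩
  | mul x y _ _ hx hy =>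
    obtain ⟨u, rfl⟩ := hx
    obtain ⟨v, rfl⟩ := hy
    exact ⟨u + v, weight_add χ u v⟩
  | inv x _ hx =>
    obtain ⟨u, rfl⟩ := hx
    refine ⟨(Fintype.card H - 1) • u, eq_inv_of_mul_eq_one_left ?_⟩
    rw [weight_nsmul, ← pow_succ, Nat.sub_add_cancel Fintype.card_pos, pow_card_eq_one]

end Weight

section Representation

variable (k : Type) [Field k] {H : Type} [CommGroup H] {n : ℕ} (χ : Fin n → H)

open Classical in
/-- The projection of the polynomial ring onto its homogeneous part of degree `ρ⁻¹`. -/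
noncomputable def degreeProj (ρ : H) : Module.End k (MvPolynomial (Fin n) k) :=
  (basisMonomials (Fin n) k).constr k fun u => if weight χ u = ρ⁻¹ then monomial u 1 else 0

open Classical in
lemma degreeProj_monomial (ρ : H) (u : Fin n →₀ ℕ) (c : k) :
    degreeProj k χ ρ (monomial u c) = if weight χ u = ρ⁻¹ then monomial u c else 0 := by
  have h1 : (monomial u c : MvPolynomial (Fin n) k) = c • basisMonomials (Fin n) k u := by
    simp [smul_monomial]
  rw [h1, map_smul, degreeProj, Module.Basis.constr_basis]
  split_ifs <;> simp

lemma coeff_degreeProj {ρ : H} {u : Fin n →₀ ℕ} (hu : weight χ u = ρ⁻¹)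
    (f : MvPolynomial (Fin n) k) : coeff u (degreeProj k χ ρ f) = coeff u f := by
  classical
  induction f using MvPolynomial.induction_on' with
  | monomial v c =>
    rw [degreeProj_monomial]
    split_ifs with hv
    · rfl
    · rw [coeff_zero, coeff_monomial, if_neg]
      rintro rfl
      exact hv hu
  | add p q hp hq => simp [hp, hq]

lemma degreeProj_mul_self (ρ : H) : degreeProj k χ ρ * degreeProj k χ ρ = degreeProj k χ ρ := by
  refine end_ext_monomial fun u => ?_
  simp only [Module.End.mul_apply, degreeProj_monomial]
  split_ifs with h
  · rw [degreeProj_monomial, if_pos h]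
  · simp

lemma degreeProj_mul_of_ne {ρ τ : H} (hne : ρ ≠ τ) : degreeProj k χ ρ * degreeProj k χ τ = 0 := by
  refine end_ext_monomial fun u => ?_
  simp only [Module.End.mul_apply, degreeProj_monomial]
  split_ifs with h
  · rw [degreeProj_monomial, if_neg]
    · simp
    · exact fun h' => hne (inv_injective (h'.symm.trans h))
  · simp

lemma mulLeft_mul_degreeProj (i : Fin n) (ρ : H) :
    LinearMap.mulLeft k (X i) * degreeProj k χ (ρ * χ i) =
      degreeProj k χ ρ * LinearMap.mulLeft k (X i) := by
  refine end_ext_monomial fun u => ?_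
  have hX : (X i * monomial u 1 : MvPolynomial (Fin n) k) =
      monomial (Finsupp.single i 1 + u) 1 := by
    rw [X, monomial_mul, one_mul]
  have hiff : weight χ (Finsupp.single i 1 + u) = ρ⁻¹ ↔ weight χ u = (ρ * χ i)⁻¹ := by
    rw [weight_add, weight_single, mul_inv, eq_mul_inv_iff_mul_eq, mul_comm]
  simp only [Module.End.mul_apply, degreeProj_monomial, LinearMap.mulLeft_apply, hX]
  by_cases h : weight χ u = (ρ * χ i)⁻¹
  · rw [if_pos h, if_pos (hiff.2 h), hX]
  · rw [if_neg h, if_neg (mt hiff.1 h), mul_zero]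

/-- The images of the generators of the path algebra in the endomorphisms of the polynomial
ring. -/
noncomputable def genRep : McKayGen H n → Module.End k (MvPolynomial (Fin n) k)
  | .e ρ => degreeProj k χ ρ
  | .a i ρ => degreeProj k χ ρ * LinearMap.mulLeft k (X i)

/-- The endomorphism of the polynomial ring given by the action of `g ∈ G = Hom(H, kˣ)`. -/
noncomputable abbrev diagAction (g : H →* kˣ) : Module.End k (MvPolynomial (Fin n) k) :=
  (aeval fun i : Fin n => ((g (χ i) : k) • X i : MvPolynomial (Fin n) k)).toLinearMap

lemma diagAction_monomial (g : H →* kˣ) (u : Fin n →₀ ℕ) (c : k) :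
    diagAction k χ g (monomial u c) = (g (weight χ u) : k) • monomial u c := by
  simp only [AlgHom.toLinearMap_apply, aeval_monomial, weight, smul_pow, map_prod, map_pow,
    Units.coe_prod, Units.val_pow_eq_pow_val]
  rw [Finsupp.prod_fintype _ _ (by simp), Finset.prod_smul, monomial_eq,
    Finsupp.prod_fintype _ _ (by simp), algebraMap_eq, mul_smul_comm]

variable [Fintype H]

lemma diagAction_eq_sum (g : H →* kˣ) :
    diagAction k χ g = ∑ ρ : H, (g ρ⁻¹ : k) • degreeProj k χ ρ := by
  classical
  refine end_ext_monomial fun u => ?_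
  simp only [LinearMap.sum_apply, LinearMap.smul_apply, diagAction_monomial,
    degreeProj_monomial]
  rw [Finset.sum_eq_single (weight χ u)⁻¹]
  · simp
  · intro ρ _ hρ
    rw [if_neg, smul_zero]
    rintro h
    exact hρ (by rw [h, inv_inv])
  · simp

lemma degreeProj_eq_sum [IsAlgClosed k] [Fintype (H →* kˣ)]
    (hchar : (Fintype.card H : k) ≠ 0) (ρ : H) :
    degreeProj k χ ρ =
      (Fintype.card H : k)⁻¹ • ∑ g : H →* kˣ, (g ρ : k) • diagAction k χ g := by
  classical
  refine end_ext_monomial fun u => ?_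
  simp only [LinearMap.sum_apply, LinearMap.smul_apply, diagAction_monomial,
    degreeProj_monomial, smul_smul, ← Units.val_mul, ← map_mul, ← Finset.sum_smul,
    sum_monoidHom_apply k H hchar]
  rw [mul_comm ρ, ← eq_inv_iff_mul_eq_one]
  split_ifs
  · rw [inv_mul_cancel₀ hchar, one_smul]
  · simp

lemma sum_degreeProj : ∑ ρ : H, degreeProj k χ ρ = 1 := by
  have h := diagAction_eq_sum k χ 1
  simp only [MonoidHom.one_apply, Units.val_one, one_smul] at h
  rw [← h]
  refine end_ext_monomial fun u => ?_
  simp only [diagAction_monomial]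
  simp

/-- The action of the McKay toric algebra on the polynomial ring. -/
noncomputable def rep : McKayAlgebra k H n χ →ₐ[k] Module.End k (MvPolynomial (Fin n) k) :=
  RingQuot.liftAlgHom k ⟨FreeAlgebra.lift k (genRep k χ), by
    intro x y hxy
    cases hxy with
    | orth ρ τ h => simp [genRep, degreeProj_mul_of_ne k χ h]
    | idem ρ => simp [genRep, degreeProj_mul_self]
    | sum => simp [genRep, sum_degreeProj]
    | hd i ρ => simp [genRep, ← mul_assoc, degreeProj_mul_self]
    | tl i ρ =>
      simp only [map_mul, FreeAlgebra.lift_ι_apply, genRep]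
      rw [mul_assoc, mulLeft_mul_degreeProj, ← mul_assoc, degreeProj_mul_self]
    | comm i j ρ =>
      have key : ∀ i j : Fin n, degreeProj k χ ρ * LinearMap.mulLeft k (X j) *
          (degreeProj k χ (ρ * χ j) * LinearMap.mulLeft k (X i)) =
          degreeProj k χ ρ * LinearMap.mulLeft k (X j * X i) := by
        intro i j
        rw [mul_assoc, ← mul_assoc (LinearMap.mulLeft k (X j)), mulLeft_mul_degreeProj,
          ← mul_assoc, ← mul_assoc, degreeProj_mul_self, LinearMap.mulLeft_mul]
        rfl
      simp only [map_mul, FreeAlgebra.lift_ι_apply, genRep]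
      rw [key, key, mul_comm]⟩

end Representation

section Algebra

variable (k : Type) [Field k] {H : Type} [CommGroup H] [Fintype H] {n : ℕ} (χ : Fin n → H)

/-- The trivial path at `ρ`. -/
noncomputable def vertex (ρ : H) : McKayAlgebra k H n χ :=
  RingQuot.mkAlgHom k _ (FreeAlgebra.ι k (McKayGen.e ρ))

/-- The class of the arrow `a_i^ρ`. -/
noncomputable def arrow (i : Fin n) (ρ : H) : McKayAlgebra k H n χ :=
  RingQuot.mkAlgHom k _ (FreeAlgebra.ι k (McKayGen.a i ρ))

/-- The sum of all arrows labelled `x_i`. -/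
noncomputable def arrowSum (i : Fin n) : McKayAlgebra k H n χ := ∑ ρ, arrow k χ i ρ

lemma vertex_mul_vertex [DecidableEq H] (ρ τ : H) :
    vertex k χ ρ * vertex k χ τ = if ρ = τ then vertex k χ ρ else 0 := by
  split_ifs with h
  · subst h
    simpa [vertex] using RingQuot.mkAlgHom_rel k (McKayRel.idem (k := k) (χ := χ) ρ)
  · simpa [vertex] using RingQuot.mkAlgHom_rel k (McKayRel.orth (k := k) (χ := χ) ρ τ h)

lemma sum_vertex : ∑ ρ, vertex k χ ρ = 1 := by
  simpa [vertex] using RingQuot.mkAlgHom_rel k (McKayRel.sum (k := k) (χ := χ))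

lemma vertex_mul_arrow (i : Fin n) (ρ : H) : vertex k χ ρ * arrow k χ i ρ = arrow k χ i ρ := by
  simpa [vertex, arrow] using RingQuot.mkAlgHom_rel k (McKayRel.hd (k := k) (χ := χ) i ρ)

lemma arrow_mul_vertex (i : Fin n) (ρ : H) :
    arrow k χ i ρ * vertex k χ (ρ * χ i) = arrow k χ i ρ := by
  simpa [vertex, arrow] using RingQuot.mkAlgHom_rel k (McKayRel.tl (k := k) (χ := χ) i ρ)

lemma arrow_mul_arrow (i j : Fin n) (ρ : H) :
    arrow k χ j ρ * arrow k χ i (ρ * χ j) = arrow k χ i ρ * arrow k χ j (ρ * χ i) := by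
  simpa [arrow] using RingQuot.mkAlgHom_rel k (McKayRel.comm (k := k) (χ := χ) i j ρ)

lemma vertex_mul_arrowSum (i : Fin n) (ρ : H) :
    vertex k χ ρ * arrowSum k χ i = arrow k χ i ρ := by
  classical
  rw [arrowSum, Finset.mul_sum, Finset.sum_eq_single ρ]
  · exact vertex_mul_arrow k χ i ρ
  · intro τ _ hτ
    rw [← vertex_mul_arrow, ← mul_assoc, vertex_mul_vertex, if_neg hτ.symm, zero_mul]
  · simp

lemma arrowSum_mul_vertex (i : Fin n) (ρ : H) :
    arrowSum k χ i * vertex k χ (ρ * χ i) = arrow k χ i ρ := by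
  classical
  rw [arrowSum, Finset.sum_mul, Finset.sum_eq_single ρ]
  · exact arrow_mul_vertex k χ i ρ
  · intro τ _ hτ
    rw [← arrow_mul_vertex, mul_assoc, vertex_mul_vertex, if_neg (by simpa using hτ), mul_zero]
  · simp

lemma arrowSum_mul_arrowSum (i j : Fin n) :
    arrowSum k χ i * arrowSum k χ j = arrowSum k χ j * arrowSum k χ i := by
  have key : ∀ i j : Fin n, arrowSum k χ i * arrowSum k χ j =
      ∑ ρ, arrow k χ i ρ * arrow k χ j (ρ * χ i) := by
    intro i j
    conv_lhs => rw [arrowSum, Finset.sum_mul]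
    refine Finset.sum_congr rfl fun ρ _ => ?_
    rw [← vertex_mul_arrowSum k χ j, ← mul_assoc, arrow_mul_vertex]
  rw [key, key]
  exact Finset.sum_congr rfl fun ρ _ => arrow_mul_arrow k χ j i ρ

/-- Every element of the McKay toric algebra has the form `∑ e_ρ f_ρ` with `f_ρ` polynomials in
the `arrowSum k χ i`. -/
lemma exists_eq_sum_vertex_mul {Y : MvPolynomial (Fin n) k →ₐ[k] McKayAlgebra k H n χ}
    (hY : ∀ i, Y (X i) = arrowSum k χ i) (z : McKayAlgebra k H n χ) :
    ∃ f : H → MvPolynomial (Fin n) k, z = ∑ ρ, vertex k χ ρ * Y (f ρ) := by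
  classical
  have key : ∀ (w : FreeAlgebra k (McKayGen H n)) (f : H → MvPolynomial (Fin n) k),
      ∃ f' : H → MvPolynomial (Fin n) k,
        RingQuot.mkAlgHom k (McKayRel k H n χ) w * ∑ ρ, vertex k χ ρ * Y (f ρ) =
          ∑ ρ, vertex k χ ρ * Y (f' ρ) := by
    intro w
    induction w using FreeAlgebra.induction with
    | grade0 r =>
      intro f
      refine ⟨r • f, ?_⟩
      simp [← Algebra.smul_def, Finset.smul_sum]
    | grade1 x =>
      intro f
      rcases x with τ | ⟨i, τ⟩
      · refine ⟨Pi.single τ (f τ), ?_⟩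
        change vertex k χ τ * _ = _
        rw [Finset.mul_sum]
        refine Finset.sum_congr rfl fun ρ _ => ?_
        rw [← mul_assoc, vertex_mul_vertex]
        by_cases h : τ = ρ
        · subst h
          simp
        · simp [h]
      · refine ⟨Pi.single τ (X i * f (τ * χ i)), ?_⟩
        change arrow k χ i τ * _ = _
        rw [Finset.mul_sum, Finset.sum_eq_single (τ * χ i), Finset.sum_eq_single τ]
        · rw [Pi.single_eq_same, map_mul, hY, ← mul_assoc, ← mul_assoc, arrow_mul_vertex,
            vertex_mul_arrowSum]
        · intro ρ _ h
          simp [Pi.single_eq_of_ne h]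
        · simp
        · intro ρ _ h
          rw [← arrow_mul_vertex, mul_assoc, ← mul_assoc (vertex k χ _), vertex_mul_vertex,
            if_neg h.symm, zero_mul, mul_zero]
        · simp
    | mul a b ha hb =>
      intro f
      obtain ⟨f₁, h₁⟩ := hb f
      obtain ⟨f₂, h₂⟩ := ha f₁
      exact ⟨f₂, by rw [map_mul, mul_assoc, h₁, h₂]⟩
    | add a b ha hb =>
      intro f
      obtain ⟨f₁, h₁⟩ := ha f
      obtain ⟨f₂, h₂⟩ := hb f
      exact ⟨f₁ + f₂, by simp [add_mul, h₁, h₂, mul_add, Finset.sum_add_distrib]⟩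
  obtain ⟨w, rfl⟩ := RingQuot.mkAlgHom_surjective k (McKayRel k H n χ) z
  simpa [sum_vertex] using key w 1

lemma rep_vertex (ρ : H) : rep k χ (vertex k χ ρ) = degreeProj k χ ρ := by
  simp [rep, vertex, RingQuot.liftAlgHom_mkAlgHom_apply, genRep]

lemma rep_arrow (i : Fin n) (ρ : H) :
    rep k χ (arrow k χ i ρ) = degreeProj k χ ρ * LinearMap.mulLeft k (X i) := by
  simp [rep, arrow, RingQuot.liftAlgHom_mkAlgHom_apply, genRep]

lemma rep_arrowSum (i : Fin n) : rep k χ (arrowSum k χ i) = LinearMap.mulLeft k (X i) := by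
  rw [arrowSum, map_sum]
  simp only [rep_arrow]
  rw [← Finset.sum_mul, sum_degreeProj, one_mul]

lemma rep_injective (hgen : Subgroup.closure (Set.range χ) = ⊤) :
    Function.Injective (rep k χ) := by
  obtain ⟨Y, hY⟩ := exists_algHom_X_eq (k := k) (arrowSum k χ) (arrowSum_mul_arrowSum k χ)
  have hrepY : (rep k χ).comp Y = Algebra.lmul k (MvPolynomial (Fin n) k) :=
    algHom_ext fun i => by
      rw [AlgHom.comp_apply, hY, rep_arrowSum]
      rfl
  rw [injective_iff_map_eq_zero]
  intro z hz
  obtain ⟨f, rfl⟩ := exists_eq_sum_vertex_mul k χ hY z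
  suffices hf : ∀ ρ, f ρ = 0 by simp [hf]
  intro ρ
  have hρ : degreeProj k χ ρ * Algebra.lmul k _ (f ρ) = 0 := by
    classical
    have h := congrArg (fun T => degreeProj k χ ρ * T) hz
    simp only [map_sum, map_mul, rep_vertex, mul_zero, Finset.mul_sum] at h
    rw [Finset.sum_eq_single ρ] at h
    · rw [← hrepY, AlgHom.comp_apply, ← h, ← mul_assoc, degreeProj_mul_self]
    · intro τ _ hτ
      rw [← mul_assoc, degreeProj_mul_of_ne k χ hτ.symm, zero_mul]
    · simp
  ext m
  obtain ⟨u, hu⟩ := weight_surjective χ hgen ((weight χ m)⁻¹ * ρ⁻¹)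
  have hmu : weight χ (m + u) = ρ⁻¹ := by rw [weight_add, hu, mul_inv_cancel_left]
  have h := congrArg (coeff (m + u)) (LinearMap.congr_fun hρ (monomial u 1))
  rw [Module.End.mul_apply, coeff_degreeProj k χ hmu] at h
  simpa using h

lemma range_rep [IsAlgClosed k] (hchar : (Fintype.card H : k) ≠ 0) :
    (rep k χ).range = SkewGroupAlgebra k H n χ := by
  have := Fintype.ofFinite (H →* kˣ)
  have hmulLeft : ∀ i : Fin n, LinearMap.mulLeft k (X i) ∈ SkewGroupAlgebra k H n χ :=
    fun i => Algebra.subset_adjoin (Or.inl ⟨i, rfl⟩)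
  have hdegreeProj : ∀ ρ : H, degreeProj k χ ρ ∈ SkewGroupAlgebra k H n χ := by
    intro ρ
    rw [degreeProj_eq_sum k χ hchar]
    refine Subalgebra.smul_mem _ (Subalgebra.sum_mem _ fun g _ => Subalgebra.smul_mem _ ?_ _) _
    exact Algebra.subset_adjoin (Or.inr ⟨g, rfl⟩)
  refine le_antisymm ?_ (Algebra.adjoin_le ?_)
  · rintro _ ⟨z, rfl⟩
    obtain ⟨w, rfl⟩ := RingQuot.mkAlgHom_surjective k (McKayRel k H n χ) z
    induction w using FreeAlgebra.induction with
    | grade0 r =>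
      simp
    | grade1 x =>
      rcases x with ρ | ⟨i, ρ⟩
      · exact (rep_vertex k χ ρ).symm ▸ hdegreeProj ρ
      · exact (rep_arrow k χ i ρ).symm ▸ mul_mem (hdegreeProj ρ) (hmulLeft i)
    | mul a b ha hb => simpa using! mul_mem ha hb
    | add a b ha hb => simpa using! add_mem ha hb
  · rintro _ (⟨i, rfl⟩ | ⟨g, rfl⟩)
    · exact ⟨arrowSum k χ i, rep_arrowSum k χ i⟩
    · refine ⟨∑ ρ, (g ρ⁻¹ : k) • vertex k χ ρ, ?_⟩
      refine Eq.trans ?_ (diagAction_eq_sum k χ g).symm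
      change rep k χ _ = _
      simp only [map_sum, map_smul, rep_vertex]

end Algebra

end NCCell

/-- Lemma 4.1: let `G ⊂ GL(n,k)` be a finite abelian subgroup of
diagonal matrices containing no quasireflections, over an algebraically closed field
`k` whose characteristic does not divide `|G|`; it is described by its character group
`H = G*` together with the coordinate characters `χ i ∈ H` (which generate `H` since
`G` embeds in the diagonal torus; absence of quasireflections says the `χ j`, `j ≠ i`,
already generate, and `G = Hom(H, kˣ)`).  Then the McKay toric algebra
`A_𝓔 = kQ/J_𝓔` of the McKay collection `𝓔 = (E_ρ : ρ ∈ G*)` is isomorphic as a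
`k`-algebra to the skew group algebra `k[x₁,…,x_n] ∗ G`. -/
theorem mckay_toric_algebra_iso_skew_group_algebra
    (k : Type) [Field k] [IsAlgClosed k]
    (H : Type) [CommGroup H] [Fintype H] (n : ℕ) (χ : Fin n → H)
    (hchar : (Fintype.card H : k) ≠ 0)
    (hgen : Subgroup.closure (Set.range χ) = ⊤)
    (hnoquasi : ∀ (g : H →* kˣ) (i : Fin n), (∀ j, j ≠ i → g (χ j) = 1) → g = 1) :
    Nonempty (McKayAlgebra k H n χ ≃ₐ[k] ↥(SkewGroupAlgebra k H n χ)) := by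
  exact ⟨(AlgEquiv.ofInjective (rep k χ) (rep_injective k χ hgen)).trans
    (Subalgebra.equivOfEq _ _ (range_rep k χ hchar))⟩
end

section
/- Let G ⊂ SL(n,k) be a finite abelian subgroup containing no quasireflections. Then every anticanonical cycle in the McKay quiver Q can be written uniquely as a_n^ρ a_{σ(n−1)}^{ρρ_{σ(n−1)}} ⋯ a_{σ(2)}^{ρρ_{σ(2)}⋯ρ_{σ(n−1)}} a_{σ(1)}^{ρρ_{σ(1)}⋯ρ_{σ(n−1)}} for some vertex ρ ∈ G* and permutation σ of {1,…,n−1} (normalising so the final arrow has label x_n), and the ideal of superpotential relations J_W of the resulting superpotential W coincides with J_E; that is, the McKay toric algebra A_E is consistent. -/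
namespace NCCell

/-! The McKay quiver of a finite abelian diagonal subgroup `G ⊂ SL(n+1, k)` without
quasireflections, described through its character group `H = G*` and the characters
`χ i ∈ H` of the coordinates of the diagonal embedding: vertices are the elements of
`H`, and for each `ρ ∈ H` and each `i` there is an arrow `a_i^ρ : ρ·χ i → ρ` labelled
`x_i`.  A path is recorded by its head `ρ ∈ H` together with the list `l` of the
indices of its arrows in composition order (arrow traversed last first); its tail is
`ρ * Π_{i ∈ l} χ i` and its labelling divisor is `i ↦ count of i in l`. -/

variable {H : Type} [CommGroup H] {n : ℕ}

/-- The tail of the path with head `ρ` whose arrows are labelled by the list `l`. -/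
def mTail (χ : Fin (n + 1) → H) (ρ : H) (l : List (Fin (n + 1))) : H :=
  ρ * (l.map χ).prod

/-- `lp - lm` is a generating superpotential relation of `J_W` for the McKay quiver:
for some path `q` (with index list `m`), the derivative `∂_q W` of the superpotential
`W = Σ_{anticanonical cycles} p` is the sum of precisely the two paths `lp, lm`
(those with labelling divisor complementary to that of `q`), and these two paths share
neither initial nor final arrow.  (By homogeneity of the McKay quiver this condition
does not depend on the basepoint.) -/
def IsMcKaySPRel (lp lm : List (Fin (n + 1))) : Prop :=
  ∃ m : List (Fin (n + 1)),
    (∀ i, lp.count i + m.count i = 1) ∧ (∀ i, lm.count i + m.count i = 1) ∧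
    lp ≠ lm ∧ lp.head? ≠ lm.head? ∧ lp.getLast? ≠ lm.getLast? ∧
    (∀ l : List (Fin (n + 1)), (∀ i, l.count i + m.count i = 1) → l = lp ∨ l = lm)

/-- F-term equivalence of paths (pairs of a head vertex and an index list) in the
McKay quiver: the equivalence relation generated by substituting `lp ↔ lm` for
superpotential relations `lp - lm ∈ J_W`, in arbitrary path contexts. -/
inductive McKayFTerm (χ : Fin (n + 1) → H) :
    H × List (Fin (n + 1)) → H × List (Fin (n + 1)) → Prop
  | rel (ρ : H) (l₁ l₂ lp lm : List (Fin (n + 1))) (h : IsMcKaySPRel lp lm) :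
      McKayFTerm χ (ρ, l₁ ++ lp ++ l₂) (ρ, l₁ ++ lm ++ l₂)
  | refl (x) : McKayFTerm χ x x
  | symm {x y} : McKayFTerm χ x y → McKayFTerm χ y x
  | trans {x y z} : McKayFTerm χ x y → McKayFTerm χ y z → McKayFTerm χ x z

end NCCell

open NCCell

namespace NCCell

theorem isMcKaySPRel_pair {n : ℕ} {i j : Fin (n + 1)} (hij : i ≠ j) :
    IsMcKaySPRel [i, j] [j, i] := by
  have hm : ∀ a, ((List.finRange (n + 1)).filter fun a => a ≠ i ∧ a ≠ j).count a =
      if a ≠ i ∧ a ≠ j then 1 else 0 := by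
    intro a
    split_ifs with h
    · rw [List.count_filter (by simpa using h)]
      exact List.count_eq_one_of_mem (List.nodup_finRange _) (List.mem_finRange a)
    · exact List.count_eq_zero.2 fun hmem => h (by simpa using hmem)
  have hpair : ∀ a, [i, j].count a + (if a ≠ i ∧ a ≠ j then 1 else 0) = 1 := by
    intro a
    by_cases hi : a = i
    · subst hi
      simp [hij.symm]
    · by_cases hj : a = j
      · subst hj
        simp [hij]
      · simp [hi, hj, Ne.symm hi, Ne.symm hj]
  have hswap : [j, i].Perm [i, j] := List.Perm.swap _ _ _
  refine ⟨(List.finRange (n + 1)).filter fun a => a ≠ i ∧ a ≠ j, fun a => ?_, fun a => ?_,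
    by simp [hij], by simp [hij], by simp [hij.symm], fun l hl => ?_⟩
  · rw [hm, hpair]
  · rw [hm, hswap.count_eq, hpair]
  · have hperm : l.Perm [i, j] := List.perm_iff_count.2 fun a => by
      have h₁ := hl a
      have h₂ := hpair a
      rw [hm] at h₁
      omega
    obtain ⟨x, y, rfl⟩ := List.length_eq_two.1 hperm.length_eq
    have hx : x = i ∨ x = j := by simpa using hperm.mem_iff.1 (List.mem_cons_self)
    have hnd : x ≠ y := by simpa using hperm.nodup_iff.2 (by simpa using hij)
    have hy : y = i ∨ y = j := by simpa using hperm.mem_iff.1 (show y ∈ [x, y] by simp)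
    rcases hx with rfl | rfl <;> rcases hy with rfl | rfl <;> simp_all

theorem IsMcKaySPRel.perm {n : ℕ} {lp lm : List (Fin (n + 1))} (h : IsMcKaySPRel lp lm) :
    lp.Perm lm := by
  obtain ⟨m, hp, hm, -⟩ := h
  exact List.perm_iff_count.2 fun a => Nat.add_right_cancel ((hp a).trans (hm a).symm)

namespace McKayFTerm

variable {H : Type} {n : ℕ} {χ : Fin (n + 1) → H}

theorem perm {x y : H × List (Fin (n + 1))} (h : McKayFTerm χ x y) : x.2.Perm y.2 := by
  induction h with
  | rel ρ l₁ l₂ lp lm h => exact (h.perm.append_left l₁).append_right l₂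
  | refl x => exact List.Perm.refl _
  | symm _ ih => exact ih.symm
  | trans _ _ ih₁ ih₂ => exact ih₁.trans ih₂

theorem of_perm_append (ρ : H) {l l' : List (Fin (n + 1))} (h : l.Perm l') :
    ∀ l₁ : List (Fin (n + 1)), McKayFTerm χ (ρ, l₁ ++ l) (ρ, l₁ ++ l') := by
  induction h with
  | nil => exact fun _ => refl _
  | cons x _ ih => exact fun l₁ => by simpa using ih (l₁ ++ [x])
  | swap x y l =>
    intro l₁
    by_cases hxy : y = x
    · subst hxy
      exact refl _
    · simpa using rel (χ := χ) ρ l₁ l _ _ (isMcKaySPRel_pair hxy)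
  | trans _ _ ih₁ ih₂ => exact fun l₁ => (ih₁ l₁).trans (ih₂ l₁)

theorem iff_perm (ρ : H) (l l' : List (Fin (n + 1))) :
    McKayFTerm χ (ρ, l) (ρ, l') ↔ l.Perm l' :=
  ⟨perm, fun h => of_perm_append ρ h []⟩

end McKayFTerm

theorem eq_of_isRotated_ofFn {α : Type*} {n : ℕ} {f g : Fin (n + 1) → α}
    (hg : Function.Injective g) (h₀ : f 0 = g 0)
    (h : (List.ofFn g).IsRotated (List.ofFn f)) : f = g := by
  obtain ⟨k, hk, hrot⟩ := List.isRotated_iff_mod.1 h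
  have hlt : k % (n + 1) < n + 1 := Nat.mod_lt _ n.succ_pos
  have hhead : g ⟨k % (n + 1), hlt⟩ = f 0 := by
    have := congrArg (fun l => l[0]?) hrot
    simpa [-List.ofFn_succ, List.getElem?_rotate, hlt] using this
  have hmod : k % (n + 1) = 0 := congrArg Fin.val (hg (hhead.trans h₀))
  refine List.ofFn_injective ?_
  rw [← hrot, ← List.rotate_mod, List.length_ofFn, hmod, List.rotate_zero]

theorem exists_perm_isRotated_ofFn {n : ℕ} {l : List (Fin (n + 1))}
    (hl : l.Perm (List.finRange (n + 1))) (a : Fin (n + 1)) :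
    ∃ σ : Equiv.Perm (Fin (n + 1)), σ 0 = a ∧ l.IsRotated (List.ofFn σ) := by
  obtain ⟨s, t, rfl⟩ := List.append_of_mem (hl.mem_iff.2 (List.mem_finRange a))
  have hrot : (s ++ a :: t).IsRotated (a :: t ++ s) := List.isRotated_append
  have hperm := hrot.perm.symm.trans hl
  obtain ⟨r, hr⟩ : ∃ r, a :: t ++ s = a :: r := ⟨t ++ s, rfl⟩
  rw [hr] at hrot hperm
  have hlen : (a :: r).length = n + 1 := by simpa using hperm.length_eq
  let f : Fin (n + 1) → Fin (n + 1) := fun i => (a :: r)[i]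
  have hf : Function.Injective f := fun i j hij =>
    Fin.ext ((hperm.nodup_iff.2 (List.nodup_finRange _)).getElem_inj_iff.1 hij)
  refine ⟨Equiv.ofBijective f (Finite.injective_iff_bijective.1 hf), rfl, ?_⟩
  convert hrot using 1
  exact List.ext_getElem (by simpa using hlen.symm) fun i h₁ h₂ => by simp [-List.ofFn_succ, f]

end NCCell

/-- §4.1: let `G ⊂ SL(n+1,k)` be a finite abelian subgroup without
quasireflections, with character group `H = G*` and coordinate characters `χ i`
(generating `H`, with `Π i, χ i = 1` since `G ⊂ SL`; absence of quasireflections says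
that the `χ j` for `j ≠ i` already generate).  Then:
(1) every anticanonical cycle of the McKay quiver — i.e. every path `(ρ, l)` whose
labelling divisor is `(1,…,1)` — is a cycle, and can be written uniquely in the normal
form `a_{n+1}^ρ a_{σ(n)}^{…} ⋯ a_{σ(1)}^{…}`: there is a unique permutation `σ` of
`{1,…,n+1}` with `σ(1) = n+1` (the final arrow is labelled `x_{n+1}`) such that `l` is
a rotation of the listing of `σ`; and
(2) the ideal `J_W` of superpotential relations coincides with `J_𝓔`, i.e. the McKay
toric algebra `A_𝓔` is consistent: two paths with the same head and tail are identified
in `A_𝓔` (have equal labelling divisors) iff they are F-term equivalent. -/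
theorem mckay_superpotential_consistent
    {H : Type} [CommGroup H] [Fintype H] {n : ℕ} (χ : Fin (n + 1) → H)
    (hSL : ∏ i, χ i = 1)
    (hnoquasi : ∀ i : Fin (n + 1), Subgroup.closure (χ '' {j | j ≠ i}) = ⊤) :
    (∀ (ρ : H) (l : List (Fin (n + 1))), (∀ i, l.count i = 1) →
      mTail χ ρ l = ρ ∧
      ∃! σ : Equiv.Perm (Fin (n + 1)),
        σ 0 = Fin.last n ∧ l.IsRotated (List.ofFn σ))
    ∧ (∀ (ρ : H) (l l' : List (Fin (n + 1))),
        (∀ i, l.count i = l'.count i) ↔ McKayFTerm χ (ρ, l) (ρ, l')) := by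
  refine ⟨fun ρ l hl => ?_, fun ρ l l' => by rw [McKayFTerm.iff_perm, List.perm_iff_count]⟩
  have hperm : l.Perm (List.finRange (n + 1)) := List.perm_iff_count.2 fun a => by
    rw [hl, List.count_eq_one_of_mem (List.nodup_finRange _) (List.mem_finRange a)]
  refine ⟨?_, ?_⟩
  · rw [mTail, (hperm.map χ).prod_eq, ← List.ofFn_eq_map, List.prod_ofFn, hSL, mul_one]
  · obtain ⟨σ, hσ, hrot⟩ := exists_perm_isRotated_ofFn hperm (Fin.last n)
    exact ⟨σ, ⟨hσ, hrot⟩, fun τ hτ => DFunLike.coe_injective <|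
      eq_of_isRotated_ofFn σ.injective (hτ.1.trans hσ.symm) (hrot.symm.trans hτ.2)⟩
end

section
/- For the toric cell complex Δ of a finite abelian subgroup G ⊂ SL(n,k), the map τ: Δ → Δ that assigns to each k-cell η the unique (n−k)-cell η' with t(η') = h(η), h(η') = t(η), and x^{div(η')} = (x₁⋯x_n)/x^{div(η)} is a well-defined involution. -/
namespace NCCell

/-- The cells of the toric cell complex `Δ` of a finite abelian subgroup
`G ⊂ SL(n,k)`: `Δ` lives in the real torus `Tⁿ = ℝⁿ/M` where `M = ker(deg : ℤⁿ → G*)`,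
and its cells are the images of the faces of the unit hypercubes `C(u)`, `u ∈ ℤⁿ`.
The face of `C(u)` with minimal corner `u` spanned by the coordinate directions in a
subset `s ⊆ {1,…,n}` is recorded as the pair `(u mod M, s)`. -/
abbrev McKayCell (n : ℕ) (M : AddSubgroup (Fin n → ℤ)) :=
  ((Fin n → ℤ) ⧸ M) × Finset (Fin n)

namespace McKayCell

variable {n : ℕ} {M : AddSubgroup (Fin n → ℤ)}

/-- The dimension of a cell. -/
def dim (η : McKayCell n M) : ℕ := η.2.card

/-- The tail vertex `t(η) ∈ Δ₀` of a cell: the image of the minimal corner. -/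
def tail (η : McKayCell n M) : (Fin n → ℤ) ⧸ M := η.1

/-- The head vertex `h(η) ∈ Δ₀` of a cell: the image of the maximal corner. -/
def head (η : McKayCell n M) : (Fin n → ℤ) ⧸ M :=
  η.1 + QuotientAddGroup.mk (fun i => if i ∈ η.2 then 1 else 0)

/-- The divisor `div(η) = u_h - u_t ∈ ℕⁿ` of a cell, i.e. the indicator vector of the
set of spanned coordinate directions; `x^{div η}` is the corresponding monomial. -/
def div (η : McKayCell n M) : Fin n → ℕ := fun i => if i ∈ η.2 then 1 else 0

end McKayCell

end NCCell

namespace NCCell.McKayCell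

variable {n : ℕ} {M : AddSubgroup (Fin n → ℤ)}

/-- The dual cell: it starts at the head of `η` and spans the complementary directions. -/
def dual (η : McKayCell n M) : McKayCell n M := (η.head, η.2ᶜ)

theorem dim_dual (η : McKayCell n M) : η.dual.dim = n - η.dim := by
  simp [dual, dim, Finset.card_compl]

theorem head_dual (hM : (fun _ => 1 : Fin n → ℤ) ∈ M) (η : McKayCell n M) :
    η.dual.head = η.tail := by
  have hsum : (fun i => if i ∈ η.2 then 1 else 0 : Fin n → ℤ) +
      (fun i => if i ∈ η.2ᶜ then 1 else 0) = fun _ => 1 := by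
    funext i
    by_cases hi : i ∈ η.2 <;> simp [hi]
  change η.1 + QuotientAddGroup.mk (fun i => if i ∈ η.2 then 1 else 0) +
    QuotientAddGroup.mk (fun i => if i ∈ η.2ᶜ then 1 else 0) = η.1
  rw [add_assoc, ← QuotientAddGroup.mk_add, hsum, (QuotientAddGroup.eq_zero_iff _).mpr hM,
    add_zero]

theorem div_dual_add_div (η : McKayCell n M) (i : Fin n) : η.dual.div i + η.div i = 1 := by
  by_cases hi : i ∈ η.2 <;> simp [dual, div, hi]

theorem eq_dual_of_tail_of_div {η η' : McKayCell n M} (htail : η'.tail = η.head)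
    (hdiv : ∀ i, η'.div i + η.div i = 1) : η' = η.dual := by
  refine Prod.ext htail (Finset.ext fun i => ?_)
  have hi := hdiv i
  by_cases h : i ∈ η.2 <;> by_cases h' : i ∈ η'.2 <;> simp_all [div, dual]

theorem dual_dual (hM : (fun _ => 1 : Fin n → ℤ) ∈ M) (η : McKayCell n M) :
    η.dual.dual = η :=
  Prod.ext (head_dual hM η) (compl_compl η.2)

end NCCell.McKayCell

open NCCell McKayCell

/-- Proposition 4.7: for the toric cell complex `Δ` of a finite
abelian subgroup `G ⊂ SL(n,k)` (so `M = ker(deg) ≤ ℤⁿ` has finite index and, since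
`G ⊂ SL(n,k)`, contains `(1,…,1)`), the assignment sending a `k`-cell `η` to the unique
`(n-k)`-cell `η'` with `t(η') = h(η)`, `h(η') = t(η)` and
`x^{div η'} = (x₁⋯x_n)/x^{div η}` is a well-defined involution `τ : Δ → Δ`. -/
theorem mckay_cell_complex_duality
    {n : ℕ} (M : AddSubgroup (Fin n → ℤ))
    (hfin : M.index ≠ 0)
    (hSL : (fun _ => 1 : Fin n → ℤ) ∈ M) :
    ∃ τ : McKayCell n M → McKayCell n M,
      (∀ η : McKayCell n M,
        ((τ η).dim = n - η.dim ∧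
          (τ η).tail = η.head ∧ (τ η).head = η.tail ∧
          (∀ i, (τ η).div i + η.div i = 1)) ∧
        (∀ η' : McKayCell n M,
          (η'.dim = n - η.dim ∧ η'.tail = η.head ∧ η'.head = η.tail ∧
            (∀ i, η'.div i + η.div i = 1)) → η' = τ η)) ∧
      ∀ η, τ (τ η) = η := by
  exact ⟨dual, fun η => ⟨⟨dim_dual η, rfl, head_dual hSL η, div_dual_add_div η⟩,
    fun _ h => eq_dual_of_tail_of_div h.2.1 h.2.2.2⟩, dual_dual hSL⟩
end
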